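/- arXiv:2402.00642 — 4 statements merged into one kernel-verified Lean document; each statement's English description precedes it below -/
import Mathlib

section
/- Fix integers k, m ≥ 1, a real λ with 0 < λ < 1/2, and ε > 0. There exists n₀ such that for all n ≥ n₀ the following holds: let Σ = (a_1, …, a_n) be a sequence in ℤ^k with every entry in [0, M]^k such that e^m_Σ(A₁) ≠ e^m_Σ(A₂) for all distinct A₁, A₂ ∈ F_{λ,n} with |A₁|, |A₂| ≥ m. Let A be uniform on F_{λ,n}, X = e^m_Σ(A) ∈ ℤ^k, μ = E[X], and σ² = E[‖X − μ‖²]. Then σ² ≤ (1 + ε) · 2k(λ^{2m−1} + λ^{2m}) · n^{2m−1} · M^{2m} / ((m−1)!)². -/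
/-- `Fam n l` is the family `F_{λ,n}` of all subsets of `{1,…,n}` of size at most `λ·n`. -/
noncomputable def Fam (n : ℕ) (l : ℝ) : Finset (Finset (Fin n)) :=
  Finset.univ.filter (fun A => (A.card : ℝ) ≤ l * n)

/-- The `m`-th evaluation of the sequence `a` in `ℤ^k` on the subset `A`
(componentwise products); it is `0` when `|A| < m`. -/
def mthEvalVec (n k m : ℕ) (a : Fin n → Fin k → ℤ) (A : Finset (Fin n)) : Fin k → ℤ :=
  fun j => ∑ S ∈ A.powersetCard m, ∏ i ∈ S, a i j


namespace S6
open Finset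

/-- ratio of binomials -/
noncomputable def fr (n r s : ℕ) : ℝ := (s.choose r : ℝ) / (n.choose r : ℝ)

lemma fr_eq_prod (n r s : ℕ) :
    fr n r s = ∏ i ∈ range r, (((s - i : ℕ) : ℝ) / ((n - i : ℕ) : ℝ)) := by
  rw [prod_div_distrib, ← Nat.cast_prod, ← Nat.cast_prod, ← Nat.descFactorial_eq_prod_range,
    ← Nat.descFactorial_eq_prod_range, Nat.descFactorial_eq_factorial_mul_choose,
    Nat.descFactorial_eq_factorial_mul_choose, fr]
  push_cast
  rw [mul_div_mul_left]
  exact_mod_cast r.factorial_ne_zero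

lemma g_anti (n s i j : ℕ) (hs : s ≤ n) (hij : i ≤ j) (hj : j < n) :
    (((s - j : ℕ) : ℝ) / ((n - j : ℕ) : ℝ)) ≤ (((s - i : ℕ) : ℝ) / ((n - i : ℕ) : ℝ)) := by
  have h1 : (0:ℝ) < ((n - j : ℕ) : ℝ) := by exact_mod_cast (by omega)
  have h2 : (0:ℝ) < ((n - i : ℕ) : ℝ) := by exact_mod_cast (by omega)
  rw [div_le_div_iff₀ h1 h2]
  rcases le_total s j with h | h
  · rw [Nat.sub_eq_zero_of_le h]; push_cast; rw [zero_mul]; positivity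
  · rw [Nat.cast_sub h, Nat.cast_sub (hij.trans h), Nat.cast_sub hj.le,
      Nat.cast_sub (hij.trans hj.le)]
    have a1 : (s:ℝ) ≤ n := by exact_mod_cast hs
    have a2 : (i:ℝ) ≤ j := by exact_mod_cast hij
    nlinarith

lemma fr_nonneg (n r s : ℕ) : 0 ≤ fr n r s := by unfold fr; positivity

lemma fr_le_one (n r s : ℕ) (hs : s ≤ n) : fr n r s ≤ 1 := by
  unfold fr
  apply div_le_one_of_le₀ _ (by positivity)
  exact_mod_cast Nat.choose_le_choose r hs

lemma fr_le_pow (n r s : ℕ) (hs : s ≤ n) (hr : r ≤ n) : fr n r s ≤ ((s:ℝ) / n) ^ r := by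
  rw [fr_eq_prod]
  calc _ ≤ ∏ i ∈ range r, ((s:ℝ) / n) := by
        apply prod_le_prod
        · intro i _; positivity
        · intro i hi
          have := g_anti n s 0 i hs (Nat.zero_le _) (by have := mem_range.1 hi; omega)
          simpa using this
    _ = _ := by rw [prod_const, card_range]

lemma fr_two (n m s : ℕ) (hs : s ≤ n) (hr : 2 * m ≤ n) : fr n (2*m) s ≤ fr n m s ^ 2 := by
  rw [fr_eq_prod, two_mul, prod_range_add, sq, fr_eq_prod]
  apply mul_le_mul_of_nonneg_left _ (prod_nonneg (fun i _ => by positivity))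
  apply prod_le_prod
  · intro i _; positivity
  · intro i hi
    exact g_anti n s i (m+i) hs (by omega) (by have := mem_range.1 hi; omega)

lemma choose_diff (t s d : ℕ) :
    (s + d).choose (t+1) ≤ s.choose (t+1) + d * (s+d).choose t := by
  induction d with
  | zero => simp
  | succ d ih =>
    have h : (s + (d+1)).choose (t+1) = (s+d).choose t + (s+d).choose (t+1) := by
      rw [← add_assoc, Nat.choose_succ_succ]
    have h2 : (s+d).choose t ≤ (s+(d+1)).choose t := Nat.choose_le_choose t (by omega)
    nlinarith

lemma fr_lip (n t s L : ℕ) (hs : s ≤ L) (hL : L ≤ n) (hn : 2 * (t+1) ≤ n) :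
    (fr n (t+1) s - fr n (t+1) L)^2 ≤ (2 * ((t:ℝ)+1) / n)^2 * ((L - s : ℕ):ℝ)^2 := by
  obtain ⟨d, rfl⟩ := Nat.exists_eq_add_of_le hs
  have hn0 : (0:ℝ) < n := by exact_mod_cast (by omega)
  have hc : (0:ℝ) < (n.choose (t+1) : ℝ) := by exact_mod_cast Nat.choose_pos (by omega)
  have h1 : fr n (t+1) s ≤ fr n (t+1) (s+d) := by
    unfold fr
    gcongr
  have h2 : fr n (t+1) (s+d) - fr n (t+1) s ≤ (2 * ((t:ℝ)+1) / n) * d := by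
    unfold fr
    rw [← sub_div, div_le_iff₀ hc]
    have e1 : ((s + d).choose (t+1) : ℝ) ≤ s.choose (t+1) + d * n.choose t := by
      have := choose_diff t s d
      have h3 : (s+d).choose t ≤ n.choose t := Nat.choose_le_choose t hL
      have : (s + d).choose (t+1) ≤ s.choose (t+1) + d * n.choose t :=
        this.trans (by gcongr)
      exact_mod_cast this
    have e2 : (n.choose (t+1) : ℝ) * (t+1) = n.choose t * ((n:ℝ) - t) := by
      have := Nat.choose_succ_right_eq n t
      rw [← Nat.cast_sub (by omega)]
      exact_mod_cast this
    have e3 : (n:ℝ)/2 ≤ (n:ℝ) - t := by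
      have : (2:ℝ) * (t+1) ≤ n := by exact_mod_cast hn
      linarith
    have e4 : (n.choose t : ℝ) ≤ 2 * ((t:ℝ)+1) / n * n.choose (t+1) := by
      have : (n.choose t : ℝ) * (n/2) ≤ n.choose (t+1) * (t+1) := by
        rw [e2]; gcongr
      rw [div_mul_eq_mul_div, le_div_iff₀ hn0]
      linarith
    nlinarith [mul_le_mul_of_nonneg_left e4 (Nat.cast_nonneg (α := ℝ) d)]
  rw [← mul_pow, Nat.add_sub_cancel_left]
  rw [← neg_sub, neg_sq]
  exact pow_le_pow_left₀ (by linarith) h2 2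

lemma cnt (n s : ℕ) (R : Finset (Fin n)) :
    (#{A ∈ powersetCard s (univ : Finset (Fin n)) | R ⊆ A} : ℝ) = n.choose s * fr n #R s := by
  have hR : #R ≤ n := by simpa using card_le_univ R
  have hc : (0:ℝ) < (n.choose #R : ℝ) := by exact_mod_cast Nat.choose_pos hR
  unfold fr
  rw [← mul_div_assoc, eq_div_iff hc.ne']
  rcases le_or_gt #R s with h | h
  · rw [card_filter_powersetCard_subset _ _ _ (subset_univ R) h, card_univ, Fintype.card_fin]
    have := Nat.choose_mul (n := n) h
    rw [mul_comm]
    exact_mod_cast this.symm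
  · rw [Nat.choose_eq_zero_of_lt h, filter_eq_empty_iff.2]
    · simp
    · intro A hA hRA
      have := card_le_card hRA
      rw [(mem_powersetCard.1 hA).2] at this
      omega

lemma sum_fam (n : ℕ) (l : ℝ) (hl : 0 ≤ l) (g : Finset (Fin n) → ℝ) :
    ∑ A ∈ Fam n l, g A
      = ∑ s ∈ range (⌊l * n⌋₊ + 1), ∑ A ∈ powersetCard s (univ : Finset (Fin n)), g A := by
  have hln : 0 ≤ l * n := by positivity
  rw [← sum_fiberwise_of_maps_to (g := card) (t := range (⌊l * n⌋₊ + 1))]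
  · apply sum_congr rfl
    intro s hs
    apply sum_congr _ (fun _ _ => rfl)
    ext A
    simp only [Fam, mem_filter, mem_univ, true_and, mem_powersetCard, subset_univ]
    constructor
    · exact fun h => h.2
    · rintro rfl
      refine ⟨?_, rfl⟩
      rw [← Nat.le_floor_iff hln]
      have := mem_range.1 hs; omega
  · intro A hA
    simp only [Fam, mem_filter, mem_univ, true_and] at hA
    rw [← Nat.le_floor_iff hln] at hA
    exact mem_range.2 (by omega)

lemma sum_fam_card (n : ℕ) (l : ℝ) (hl : 0 ≤ l) (g : ℕ → ℝ) :
    ∑ A ∈ Fam n l, g #A = ∑ s ∈ range (⌊l * n⌋₊ + 1), n.choose s * g s := by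
  rw [sum_fam n l hl]
  apply sum_congr rfl
  intro s _
  rw [sum_congr rfl (g := fun _ => g s) (fun A hA => by rw [(mem_powersetCard.1 hA).2])]
  simp

lemma cnt_fam (n : ℕ) (l : ℝ) (hl : 0 ≤ l) (R : Finset (Fin n)) :
    ∑ A ∈ Fam n l, (if R ⊆ A then (1:ℝ) else 0) = ∑ A ∈ Fam n l, fr n #R #A := by
  rw [sum_fam_card n l hl (fr n #R), sum_fam n l hl]
  apply sum_congr rfl
  intro s _
  rw [← cnt, sum_boole]

lemma geo (l : ℝ) (hl0 : 0 < l) (hl : l < 1/2) : ∃ K : ℝ, 0 ≤ K ∧ ∀ n : ℕ,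
    ∑ A ∈ Fam n l, ((⌊l * n⌋₊ - #A : ℕ) : ℝ)^2 ≤ K * #(Fam n l) := by
  set q := l / (1 - l) with hq
  have hq0 : 0 < q := div_pos hl0 (by linarith)
  have hq1 : q < 1 := by rw [hq, div_lt_one (by linarith)]; linarith
  have hsum : Summable (fun j : ℕ => (j:ℝ)^2 * q^j) :=
    summable_pow_mul_geometric_of_norm_lt_one 2 (by rw [Real.norm_of_nonneg hq0.le]; exact hq1)
  refine ⟨∑' j : ℕ, (j:ℝ)^2 * q^j, tsum_nonneg (fun j => by positivity), fun n => ?_⟩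
  set L := ⌊l * n⌋₊ with hL
  have hLn : (L:ℝ) ≤ l * n := Nat.floor_le (by positivity)
  have hstep : ∀ i, i + 1 ≤ L → (n.choose i : ℝ) ≤ q * n.choose (i+1) := by
    intro i hi
    have hi' : ((i:ℝ)+1) ≤ l * n := by
      refine le_trans ?_ hLn
      exact_mod_cast hi
    have hin : i < n := by
      have : (i:ℝ) < n := by
        have : (0:ℝ) ≤ n := by positivity
        nlinarith
      exact_mod_cast this
    have e2 : (n.choose (i+1) : ℝ) * (i+1) = n.choose i * ((n:ℝ) - i) := by
      have := Nat.choose_succ_right_eq n i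
      rw [← Nat.cast_sub (by omega)]
      exact_mod_cast this
    have c0 : (0:ℝ) ≤ n.choose i := by positivity
    have c1 : (0:ℝ) ≤ n.choose (i+1) := by positivity
    rw [hq, div_mul_eq_mul_div, le_div_iff₀ (by linarith)]
    have hn0 : (0:ℝ) < n := by exact_mod_cast (by omega)
    have h3 : (n.choose i : ℝ) * (n * (1-l)) ≤ n.choose (i+1) * (l * n) := by
      calc (n.choose i : ℝ) * (n * (1-l)) ≤ n.choose i * ((n:ℝ) - i) := by
            gcongr; linarith
        _ = (n.choose (i+1) : ℝ) * (i+1) := e2.symm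
        _ ≤ _ := by gcongr
    nlinarith
  have hpow : ∀ d i, i + d = L → (n.choose i : ℝ) ≤ q^d * n.choose L := by
    intro d
    induction d with
    | zero => intro i hi; simp at hi; simp [hi]
    | succ d ih =>
      intro i hi
      have := ih (i+1) (by omega)
      have h2 := hstep i (by omega)
      rw [pow_succ']
      nlinarith
  have hN : (n.choose L : ℝ) ≤ #(Fam n l) := by
    have : powersetCard L (univ : Finset (Fin n)) ⊆ Fam n l := by
      intro A hA
      simp only [Fam, mem_filter, mem_univ, true_and]
      rw [(mem_powersetCard.1 hA).2]; exact hLn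
    have := card_le_card this
    rw [card_powersetCard, card_univ, Fintype.card_fin] at this
    exact_mod_cast this
  rw [sum_fam_card n l hl0.le (fun s => ((L - s : ℕ):ℝ)^2)]
  calc _ ≤ ∑ s ∈ range (L+1), (((L-s : ℕ):ℝ)^2 * q^(L-s)) * n.choose L := by
        apply sum_le_sum
        intro s hs
        have := hpow (L-s) s (by have := mem_range.1 hs; omega)
        nlinarith [sq_nonneg (((L - s : ℕ):ℝ))]
    _ = (∑ s ∈ range (L+1), (((s : ℕ):ℝ)^2 * q^s)) * n.choose L := by
        rw [← sum_mul]
        congr 1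
        exact sum_flip (fun s : ℕ => (s:ℝ)^2 * q^s)
    _ ≤ _ := by
        gcongr
        exact hsum.sum_le_tsum _ (fun j _ => by positivity)

end S6

namespace S6
open Finset

lemma var_eq {α : Type*} (F : Finset α) (hF : F.Nonempty) (X : α → ℝ) (c : ℝ) :
    (∑ A ∈ F, (X A - c)^2) / #F
      = (∑ A ∈ F, X A ^ 2) / #F - 2 * c * ((∑ A ∈ F, X A) / #F) + c^2 := by
  have hN : (#F : ℝ) ≠ 0 := by exact_mod_cast hF.card_pos.ne'
  have : ∑ A ∈ F, (X A - c)^2 = ∑ A ∈ F, X A ^ 2 - 2 * c * (∑ A ∈ F, X A) + #F * c^2 := by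
    rw [mul_sum, ← sum_sub_distrib, ← nsmul_eq_mul, ← sum_const, ← sum_add_distrib]
    exact sum_congr rfl (fun _ _ => by ring)
  rw [this]
  field_simp

/-- probability that a fixed `r`-set is contained in `A` -/
noncomputable def pr (n : ℕ) (l : ℝ) (r : ℕ) : ℝ := (∑ A ∈ Fam n l, fr n r #A) / #(Fam n l)

lemma fam_nonempty (n : ℕ) (l : ℝ) (hl : 0 ≤ l) : (Fam n l).Nonempty :=
  ⟨∅, by simp only [Fam, mem_filter, mem_univ, true_and, card_empty]; push_cast; positivity⟩

lemma pr_le (n : ℕ) (l : ℝ) (hl : 0 ≤ l) (r : ℕ) (c : ℝ)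
    (h : ∀ A ∈ Fam n l, fr n r #A ≤ c) : pr n l r ≤ c := by
  have hN : (0:ℝ) < (#(Fam n l) : ℝ) := by exact_mod_cast (fam_nonempty n l hl).card_pos
  unfold pr
  rw [div_le_iff₀ hN, mul_comm, ← nsmul_eq_mul]
  exact sum_le_card_nsmul _ _ _ h

lemma card_le_n {n : ℕ} (A : Finset (Fin n)) : #A ≤ n := by simpa using card_le_univ A

lemma pr_le_one (n : ℕ) (l : ℝ) (hl : 0 ≤ l) (r : ℕ) : pr n l r ≤ 1 :=
  pr_le n l hl r 1 (fun A _ => fr_le_one _ _ _ (card_le_n A))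

lemma pr_le_pow (n : ℕ) (l : ℝ) (hl : 0 ≤ l) (r : ℕ) (hr : r ≤ n) (hn : 0 < n) :
    pr n l r ≤ l ^ r := by
  refine pr_le n l hl r _ (fun A hA => (fr_le_pow _ _ _ (card_le_n A) hr).trans ?_)
  simp only [Fam, mem_filter, mem_univ, true_and] at hA
  have : (0:ℝ) < n := by exact_mod_cast hn
  apply pow_le_pow_left₀ (by positivity)
  rwa [div_le_iff₀ this]

lemma pr_two (n : ℕ) (l : ℝ) (hl0 : 0 < l) (hl : l < 1/2) (t : ℕ) (hn : 2 * (t+1) ≤ n) (K : ℝ)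
    (hK : ∑ A ∈ Fam n l, ((⌊l * n⌋₊ - #A : ℕ) : ℝ)^2 ≤ K * #(Fam n l)) :
    pr n l (2*(t+1)) - pr n l (t+1) ^ 2 ≤ (2 * ((t:ℝ)+1) / n)^2 * K := by
  have hne := fam_nonempty n l hl0.le
  have hN : (0:ℝ) < (#(Fam n l) : ℝ) := by exact_mod_cast hne.card_pos
  set L := ⌊l * n⌋₊ with hL
  have hln : 0 ≤ l * n := by positivity
  have hLn : L ≤ n := by
    have h1 : (L:ℝ) ≤ l * n := Nat.floor_le hln
    have : (L:ℝ) ≤ n := by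
      have : (0:ℝ) ≤ n := by positivity
      nlinarith
    exact_mod_cast this
  have h1 : pr n l (2*(t+1)) ≤ (∑ A ∈ Fam n l, fr n (t+1) #A ^ 2) / #(Fam n l) := by
    unfold pr
    gcongr with A hA
    exact fr_two n (t+1) _ (card_le_n A) hn
  have h2 := var_eq (Fam n l) hne (fun A => fr n (t+1) #A) (fr n (t+1) L)
  have h3 : (∑ A ∈ Fam n l, (fr n (t+1) #A - fr n (t+1) L)^2) / #(Fam n l)
      ≤ (2 * ((t:ℝ)+1) / n)^2 * K := by
    rw [div_le_iff₀ hN, mul_assoc]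
    refine le_trans ?_ (mul_le_mul_of_nonneg_left hK (sq_nonneg _))
    rw [mul_sum]
    apply sum_le_sum
    intro A hA
    apply fr_lip n t _ L _ hLn hn
    simp only [Fam, mem_filter, mem_univ, true_and] at hA
    exact (Nat.le_floor_iff hln).2 hA
  change _ = _ - 2 * _ * pr n l (t+1) + _ at h2
  nlinarith [sq_nonneg (pr n l (t+1) - fr n (t+1) L)]

lemma ind_sum {n : ℕ} (P : Finset (Finset (Fin n))) (R : Finset (Fin n)) :
    ∑ S ∈ P, ∑ T ∈ P, ((if R ⊆ S then (1:ℝ) else 0) * (if R ⊆ T then (1:ℝ) else 0))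
      = (#{S ∈ P | R ⊆ S} : ℝ)^2 := by
  rw [← sum_mul_sum, sum_boole, sq]

lemma ind_sum_all {n : ℕ} {ι : Type*} (P : Finset (Finset (Fin n))) (Q : Finset ι)
    (R : ι → Finset (Fin n)) :
    ∑ S ∈ P, ∑ T ∈ P, ∑ q ∈ Q,
      ((if R q ⊆ S then (1:ℝ) else 0) * (if R q ⊆ T then (1:ℝ) else 0))
      = ∑ q ∈ Q, (#{S ∈ P | R q ⊆ S} : ℝ)^2 := by
  have : ∀ S ∈ P, ∑ T ∈ P, ∑ q ∈ Q,
      ((if R q ⊆ S then (1:ℝ) else 0) * (if R q ⊆ T then (1:ℝ) else 0)) = ∑ q ∈ Q, ∑ T ∈ P,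
      ((if R q ⊆ S then (1:ℝ) else 0) * (if R q ⊆ T then (1:ℝ) else 0)) :=
    fun S _ => sum_comm
  rw [sum_congr rfl this, sum_comm]
  exact sum_congr rfl (fun q _ => ind_sum P (R q))

lemma var_exp (n : ℕ) (l : ℝ) (hl0 : 0 ≤ l) (m : ℕ) (x : Fin n → ℝ) :
    (∑ A ∈ Fam n l, ((∑ S ∈ A.powersetCard m, ∏ i ∈ S, x i) -
      (∑ B ∈ Fam n l, ∑ S ∈ B.powersetCard m, ∏ i ∈ S, x i) / #(Fam n l)) ^ 2) / #(Fam n l)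
    = ∑ S ∈ powersetCard m univ, ∑ T ∈ powersetCard m univ,
      (∏ i ∈ S, x i) * (∏ i ∈ T, x i) * (pr n l #(S ∪ T) - pr n l m ^ 2) := by
  have hne := fam_nonempty n l hl0
  have hN : (#(Fam n l) : ℝ) ≠ 0 := by exact_mod_cast hne.card_pos.ne'
  have hX : ∀ A : Finset (Fin n), ∑ S ∈ A.powersetCard m, ∏ i ∈ S, x i =
      ∑ S ∈ powersetCard m univ, (∏ i ∈ S, x i) * (if S ⊆ A then (1:ℝ) else 0) := by
    intro A
    simp only [mul_ite, mul_one, mul_zero]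
    rw [← sum_filter]
    apply sum_congr _ (fun _ _ => rfl)
    ext S
    simp [mem_powersetCard, and_comm]
  have hmean : (∑ B ∈ Fam n l, ∑ S ∈ B.powersetCard m, ∏ i ∈ S, x i) / #(Fam n l)
      = ∑ S ∈ powersetCard m univ, (∏ i ∈ S, x i) * pr n l m := by
    simp_rw [hX]
    rw [sum_comm, sum_div]
    apply sum_congr rfl
    intro S hS
    rw [← mul_sum, cnt_fam n l hl0, (mem_powersetCard.1 hS).2, mul_div_assoc, pr]
  have hsq : (∑ B ∈ Fam n l, (∑ S ∈ B.powersetCard m, ∏ i ∈ S, x i)^2) / #(Fam n l)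
      = ∑ S ∈ powersetCard m univ, ∑ T ∈ powersetCard m univ,
        (∏ i ∈ S, x i) * (∏ i ∈ T, x i) * pr n l #(S ∪ T) := by
    simp_rw [hX, sq, sum_mul_sum]
    rw [sum_comm, sum_div]
    apply sum_congr rfl
    intro S hS
    rw [sum_comm, sum_div]
    apply sum_congr rfl
    intro T hT
    rw [pr, ← cnt_fam n l hl0, ← mul_div_assoc, mul_sum]
    congr 1
    apply sum_congr rfl
    intro A _
    by_cases h1 : S ⊆ A <;> by_cases h2 : T ⊆ A <;> simp [h1, h2, union_subset_iff]
  rw [var_eq _ hne, hsq]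
  simp_rw [mul_sub, sum_sub_distrib]
  have : ∑ S ∈ powersetCard m univ, ∑ T ∈ powersetCard m univ,
      (∏ i ∈ S, x i) * (∏ i ∈ T, x i) * pr n l m ^ 2
      = (∑ S ∈ powersetCard m univ, (∏ i ∈ S, x i) * pr n l m)^2 := by
    rw [sq (∑ S ∈ powersetCard m univ, (∏ i ∈ S, x i) * pr n l m), sum_mul_sum]
    exact sum_congr rfl (fun _ _ => sum_congr rfl (fun _ _ => by ring))
  rw [this, ← hmean]
  ring

lemma term_le (n : ℕ) (l : ℝ) (hl0 : 0 < l) (t : ℕ) (hn : 2 * (t+1) ≤ n) (D : ℝ) (hD0 : 0 ≤ D)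
    (hD : pr n l (2*(t+1)) - pr n l (t+1) ^ 2 ≤ D) (S T : Finset (Fin n)) (hS : #S = t+1)
    (hT : #T = t+1) :
    pr n l #(S ∪ T) - pr n l (t+1) ^ 2 ≤ D
      + l^(2*t+1) * ∑ i, ((if {i} ⊆ S then (1:ℝ) else 0) * (if {i} ⊆ T then (1:ℝ) else 0))
      + ∑ p ∈ (univ : Finset (Fin n)).offDiag, ((if {p.1, p.2} ⊆ S then (1:ℝ) else 0) *
          (if {p.1, p.2} ⊆ T then (1:ℝ) else 0)) := by
  set s1 := ∑ i, ((if {i} ⊆ S then (1:ℝ) else 0) * (if {i} ⊆ T then (1:ℝ) else 0)) with hs1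
  set s2 := ∑ p ∈ (univ : Finset (Fin n)).offDiag, ((if {p.1, p.2} ⊆ S then (1:ℝ) else 0) *
          (if {p.1, p.2} ⊆ T then (1:ℝ) else 0)) with hs2
  have n1 : 0 ≤ s1 := sum_nonneg (fun i _ => by positivity)
  have n2 : 0 ≤ s2 := sum_nonneg (fun i _ => by positivity)
  have n3 : 0 ≤ l^(2*t+1) := by positivity
  have hu := card_union_add_card_inter S T
  have hq := sq_nonneg (pr n l (t+1))
  have hcase : #(S ∩ T) = 0 ∨ #(S ∩ T) = 1 ∨ 1 < #(S ∩ T) := by omega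
  rcases hcase with h | h | h
  · have : #(S ∪ T) = 2 * (t+1) := by omega
    rw [this]
    have := mul_nonneg n3 n1
    linarith
  · have e : #(S ∪ T) = 2 * t + 1 := by omega
    rw [e]
    have h1 := pr_le_pow n l hl0.le (2*t+1) (by omega) (by omega)
    obtain ⟨i, hi⟩ := card_pos.1 (by omega : 0 < #(S ∩ T))
    rw [mem_inter] at hi
    have : 1 ≤ s1 := by
      have := single_le_sum (f := fun i => ((if {i} ⊆ S then (1:ℝ) else 0) *
        (if {i} ⊆ T then (1:ℝ) else 0))) (s := univ) (fun i _ => by positivity) (mem_univ i)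
      refine le_trans (le_of_eq ?_) this
      simp [hi.1, hi.2]
    nlinarith
  · obtain ⟨i, hi, j, hj, hij⟩ := one_lt_card.1 h
    rw [mem_inter] at hi hj
    have h1 := pr_le_one n l hl0.le #(S ∪ T)
    have : 1 ≤ s2 := by
      have := single_le_sum (f := fun p : Fin n × Fin n => ((if {p.1, p.2} ⊆ S then (1:ℝ) else 0) *
          (if {p.1, p.2} ⊆ T then (1:ℝ) else 0))) (s := (univ : Finset (Fin n)).offDiag)
          (fun i _ => by positivity) (a := (i, j)) (by simp [hij])
      refine le_trans (le_of_eq ?_) this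
      simp [hi.1, hi.2, hj.1, hj.2, insert_subset_iff]
    have := mul_nonneg n3 n1
    linarith

lemma coord (n : ℕ) (l : ℝ) (hl0 : 0 < l) (hl : l < 1/2) (t : ℕ) (hn : 2 * (t+1) ≤ n) (K : ℝ)
    (hK0 : 0 ≤ K)
    (hK : ∑ A ∈ Fam n l, ((⌊l * n⌋₊ - #A : ℕ) : ℝ)^2 ≤ K * #(Fam n l))
    (M : ℝ) (hM : 0 ≤ M) (x : Fin n → ℝ) (hx : ∀ i, 0 ≤ x i ∧ x i ≤ M) :
    (∑ A ∈ Fam n l, ((∑ S ∈ A.powersetCard (t+1), ∏ i ∈ S, x i) -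
      (∑ B ∈ Fam n l, ∑ S ∈ B.powersetCard (t+1), ∏ i ∈ S, x i) / #(Fam n l)) ^ 2) / #(Fam n l)
    ≤ M^(2*(t+1)) * (l^(2*t+1) * (n:ℝ)^(2*t+1) / (t.factorial:ℝ)^2
        + (n:ℝ)^(2*t) * (1 + 4 * ((t:ℝ)+1)^2 * K)) := by
  have hn0 : (0:ℝ) < n := by exact_mod_cast (by omega)
  set D := (2 * ((t:ℝ)+1) / n)^2 * K with hDdef
  have hD0 : 0 ≤ D := by positivity
  have hD := pr_two n l hl0 hl t hn K hK
  rw [var_exp n l hl0.le]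
  set P := powersetCard (t+1) (univ : Finset (Fin n)) with hP
  have hprod : ∀ S ∈ P, 0 ≤ ∏ i ∈ S, x i ∧ ∏ i ∈ S, x i ≤ M^(t+1) := by
    intro S hS
    refine ⟨prod_nonneg (fun i _ => (hx i).1), ?_⟩
    rw [← (mem_powersetCard.1 hS).2, ← prod_const]
    exact prod_le_prod (fun i _ => (hx i).1) (fun i _ => (hx i).2)
  have hPc : (#P : ℝ) ≤ (n:ℝ)^(t+1) := by
    rw [hP, card_powersetCard, card_univ, Fintype.card_fin]
    exact_mod_cast Nat.choose_le_pow n (t+1)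
  have c1 : ∀ i : Fin n, (#{S ∈ P | {i} ⊆ S} : ℝ) ≤ (n:ℝ)^t / t.factorial := by
    intro i
    rw [hP, card_filter_powersetCard_subset _ _ _ (subset_univ _) (by simp), card_univ,
      Fintype.card_fin, card_singleton, Nat.add_sub_cancel]
    refine le_trans ?_ (Nat.choose_le_pow_div t n)
    exact_mod_cast Nat.choose_le_choose t (by omega)
  have c2 : ∀ p ∈ (univ : Finset (Fin n)).offDiag,
      (n:ℝ)^2 * (#{S ∈ P | {p.1, p.2} ⊆ S} : ℝ)^2 ≤ (n:ℝ)^(2*t) := by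
    intro p hp
    have hcard : #({p.1, p.2} : Finset (Fin n)) = 2 := card_pair (by simpa using hp)
    rw [← mul_pow, mul_comm 2 t, pow_mul]
    apply pow_le_pow_left₀ (by positivity)
    cases t with
    | zero =>
      have : #{S ∈ P | {p.1, p.2} ⊆ S} = 0 := by
        rw [card_eq_zero, filter_eq_empty_iff]
        intro S hS h
        have := card_le_card h
        rw [(mem_powersetCard.1 hS).2] at this
        omega
      rw [this]; simp
    | succ u =>
      rw [hP, card_filter_powersetCard_subset _ _ _ (subset_univ _) (by omega), card_univ,
        Fintype.card_fin, hcard, show u + 1 + 1 - 2 = u by omega, pow_succ']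
      gcongr
      have h1 : (n-2).choose u ≤ n.choose u := Nat.choose_le_choose u (by omega)
      exact_mod_cast h1.trans (Nat.choose_le_pow n u)
  set w : Finset (Fin n) → Finset (Fin n) → ℝ := fun S T => D
      + l^(2*t+1) * ∑ i, ((if {i} ⊆ S then (1:ℝ) else 0) * (if {i} ⊆ T then (1:ℝ) else 0))
      + ∑ p ∈ (univ : Finset (Fin n)).offDiag, ((if {p.1, p.2} ⊆ S then (1:ℝ) else 0) *
          (if {p.1, p.2} ⊆ T then (1:ℝ) else 0)) with hw
  have hw0 : ∀ S T, 0 ≤ w S T := fun S T => by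
    simp only [hw]
    have n1 : 0 ≤ ∑ i, ((if {i} ⊆ S then (1:ℝ) else 0) * (if {i} ⊆ T then (1:ℝ) else 0)) :=
      sum_nonneg (fun i _ => by positivity)
    have n2 : 0 ≤ ∑ p ∈ (univ : Finset (Fin n)).offDiag, ((if {p.1, p.2} ⊆ S then (1:ℝ) else 0) *
          (if {p.1, p.2} ⊆ T then (1:ℝ) else 0)) := sum_nonneg (fun i _ => by positivity)
    positivity
  calc _ ≤ ∑ S ∈ P, ∑ T ∈ P, M^(2*(t+1)) * w S T := by
        apply sum_le_sum; intro S hS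
        apply sum_le_sum; intro T hT
        have h := term_le n l hl0 t hn D hD0 hD S T (mem_powersetCard.1 hS).2
          (mem_powersetCard.1 hT).2
        have a0 := hprod S hS
        have b0 := hprod T hT
        have hab0 := mul_nonneg a0.1 b0.1
        have hab : (∏ i ∈ S, x i) * (∏ i ∈ T, x i) ≤ M^(2*(t+1)) := by
          rw [two_mul, pow_add]
          exact mul_le_mul a0.2 b0.2 b0.1 (by positivity)
        exact (mul_le_mul_of_nonneg_left h hab0).trans
          (mul_le_mul_of_nonneg_right hab (hw0 S T))
    _ = M^(2*(t+1)) * ((#P:ℝ)^2 * D + l^(2*t+1) * ∑ i, (#{S ∈ P | {i} ⊆ S} : ℝ)^2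
          + ∑ p ∈ (univ : Finset (Fin n)).offDiag, (#{S ∈ P | {p.1, p.2} ⊆ S} : ℝ)^2) := by
        simp_rw [← mul_sum]
        congr 1
        simp only [hw, sum_add_distrib, sum_const, nsmul_eq_mul, ← mul_sum]
        congr 1
        · congr 1
          · ring
          · congr 1
            exact ind_sum_all P univ (fun i => {i})
        · exact ind_sum_all P _ (fun p : Fin n × Fin n => {p.1, p.2})
    _ ≤ _ := by
        refine mul_le_mul_of_nonneg_left ?_ (by positivity)
        have e1 : (#P:ℝ)^2 * D ≤ (n:ℝ)^(2*t) * (4 * ((t:ℝ)+1)^2 * K) := by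
          calc (#P:ℝ)^2 * D ≤ ((n:ℝ)^(t+1))^2 * D := by gcongr
            _ = _ := by rw [hDdef]; field_simp; ring
        have e2 : ∑ i, (#{S ∈ P | {i} ⊆ S} : ℝ)^2 ≤ (n:ℝ)^(2*t+1) / (t.factorial:ℝ)^2 := by
          calc _ ≤ ∑ i : Fin n, ((n:ℝ)^t / t.factorial)^2 := by
                apply sum_le_sum; intro i _
                exact pow_le_pow_left₀ (by positivity) (c1 i) 2
            _ = _ := by
                rw [sum_const, card_univ, Fintype.card_fin, nsmul_eq_mul]
                ring
        have e3 : ∑ p ∈ (univ : Finset (Fin n)).offDiag, (#{S ∈ P | {p.1, p.2} ⊆ S} : ℝ)^2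
            ≤ (n:ℝ)^(2*t) := by
          calc _ ≤ ∑ p ∈ (univ : Finset (Fin n)).offDiag, (n:ℝ)^(2*t) / (n:ℝ)^2 := by
                apply sum_le_sum; intro p hp
                rw [le_div_iff₀ (by positivity), mul_comm]
                exact c2 p hp
            _ = (#(univ : Finset (Fin n)).offDiag : ℝ) * ((n:ℝ)^(2*t) / (n:ℝ)^2) := by
                rw [sum_const, nsmul_eq_mul]
            _ ≤ (n:ℝ)^2 * ((n:ℝ)^(2*t) / (n:ℝ)^2) := by
                gcongr
                rw [offDiag_card, card_univ, Fintype.card_fin, sq]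
                exact_mod_cast Nat.sub_le _ _
            _ = _ := by field_simp
        have e4 := mul_le_mul_of_nonneg_left e2 (by positivity : 0 ≤ l^(2*t+1))
        rw [mul_div_assoc]
        linarith

end S6

theorem stmt6 (k m : ℕ) (hk : 1 ≤ k) (hm : 1 ≤ m) (l : ℝ) (hl0 : 0 < l) (hl : l < 1 / 2)
    (ε : ℝ) (hε : 0 < ε) :
    ∃ n₀ : ℕ, ∀ n : ℕ, n₀ ≤ n → ∀ M : ℤ, ∀ a : Fin n → Fin k → ℤ,
      (∀ i j, 0 ≤ a i j ∧ a i j ≤ M) →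
      (∀ A₁ A₂ : Finset (Fin n), A₁ ∈ Fam n l → A₂ ∈ Fam n l → A₁ ≠ A₂ →
        m ≤ A₁.card → m ≤ A₂.card → mthEvalVec n k m a A₁ ≠ mthEvalVec n k m a A₂) →
      (∑ A ∈ Fam n l, ∑ j, ((mthEvalVec n k m a A j : ℝ) -
          (∑ B ∈ Fam n l, (mthEvalVec n k m a B j : ℝ)) / ((Fam n l).card : ℝ)) ^ 2) /
        ((Fam n l).card : ℝ) ≤
      (1 + ε) * (2 * k * (l ^ (2 * m - 1) + l ^ (2 * m))) * (n : ℝ) ^ (2 * m - 1) *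
        (M : ℝ) ^ (2 * m) / (((m - 1).factorial : ℝ)) ^ 2 := by
  obtain ⟨t, rfl⟩ : ∃ t, m = t + 1 := ⟨m - 1, by omega⟩
  obtain ⟨K, hK0, hK⟩ := S6.geo l hl0 hl
  set C := (1 + 4 * ((t:ℝ)+1)^2 * K) * (t.factorial:ℝ)^2 / l^(2*t+1) with hC
  have hf : (0:ℝ) < (t.factorial:ℝ) := by exact_mod_cast t.factorial_pos
  have hlp : 0 < l^(2*t+1) := by positivity
  refine ⟨max (2*(t+1)) ⌈C⌉₊, fun n hn M a ha _ => ?_⟩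
  have hn1 : 2 * (t+1) ≤ n := (le_max_left _ _).trans hn
  have hn2 : C ≤ n := (Nat.le_ceil C).trans (by exact_mod_cast (le_max_right _ _).trans hn)
  have hM : (0:ℝ) ≤ (M:ℝ) := by
    have := ha ⟨0, by omega⟩ ⟨0, by omega⟩
    exact_mod_cast this.1.trans this.2
  rw [Finset.sum_comm, Finset.sum_div]
  have hco : ∀ j : Fin k, (∑ A ∈ Fam n l, ((mthEvalVec n k (t+1) a A j : ℝ) -
          (∑ B ∈ Fam n l, (mthEvalVec n k (t+1) a B j : ℝ)) / ((Fam n l).card : ℝ)) ^ 2) /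
        ((Fam n l).card : ℝ) ≤ (M:ℝ)^(2*(t+1)) * (l^(2*t+1) * (n:ℝ)^(2*t+1) / (t.factorial:ℝ)^2
        + (n:ℝ)^(2*t) * (1 + 4 * ((t:ℝ)+1)^2 * K)) := by
    intro j
    have := S6.coord n l hl0 hl t hn1 K hK0 (hK n) M hM (fun i => (a i j : ℝ))
      (fun i => ⟨by exact_mod_cast (ha i j).1, by exact_mod_cast (ha i j).2⟩)
    simpa only [mthEvalVec, Int.cast_sum, Int.cast_prod] using this
  have hsmall : (n:ℝ)^(2*t) * (1 + 4 * ((t:ℝ)+1)^2 * K)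
      ≤ l^(2*t+1) * (n:ℝ)^(2*t+1) / (t.factorial:ℝ)^2 := by
    rw [hC, div_le_iff₀ hlp] at hn2
    rw [le_div_iff₀ (by positivity), pow_succ (n:ℝ)]
    have := mul_le_mul_of_nonneg_left hn2 (by positivity : 0 ≤ (n:ℝ)^(2*t))
    linarith
  rw [show 2 * (t+1) - 1 = 2*t+1 by omega, Nat.add_sub_cancel]
  calc _ ≤ ∑ j : Fin k, (M:ℝ)^(2*(t+1)) * (2 * (l^(2*t+1) * (n:ℝ)^(2*t+1) / (t.factorial:ℝ)^2)) := by
        apply Finset.sum_le_sum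
        intro j _
        refine (hco j).trans ?_
        gcongr
        linarith
    _ = 1 * (2 * k * (l^(2*t+1) + 0)) * (n:ℝ)^(2*t+1) * (M:ℝ)^(2*(t+1)) / (t.factorial:ℝ)^2 := by
        rw [Finset.sum_const, Finset.card_univ, Fintype.card_fin, nsmul_eq_mul]
        ring
    _ ≤ _ := by
        gcongr
        · linarith
        · positivity
end

section
/- Fix integers k, m ≥ 1, a real λ with 0 < λ < 1/2, and ε > 0. There exists n₀ such that for all n ≥ n₀ the following holds: if Σ = (a_1, …, a_n) is a sequence in ℤ^k with every entry in [0, M]^k such that e^m_Σ(A₁) ≠ e^m_Σ(A₂) for all distinct A₁, A₂ ∈ F_{λ,n} with |A₁|, |A₂| ≥ m, then M^{2m} ≥ (1 − ε) · (((m−1)!)² · Γ(k/2 + 1)^{2/k} / (2(λ^{2m−1} + λ^{2m}) · π · (k+2))) · |F_{λ,n}|^{2/k} / n^{2m−1}. -/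
open MeasureTheory

lemma gA_radial (k : ℕ) (hk : 1 ≤ k) (R : ℝ) (hR : 0 ≤ R) :
    ∫ y in Set.Ioi (0 : ℝ), y ^ (k - 1) • max (R ^ 2 - y ^ 2) 0
      = R ^ (k + 2) * (2 / (k * (k + 2))) := by
  have h1 : ∫ y in Set.Ioi (0 : ℝ), y ^ (k - 1) • max (R ^ 2 - y ^ 2) 0
      = ∫ y in Set.Ioc (0 : ℝ) R, (R ^ 2 * y ^ (k - 1) - y ^ (k + 1)) := by
    refine (setIntegral_eq_of_subset_of_forall_sdiff_eq_zero (s := Set.Ioc (0:ℝ) R)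
      measurableSet_Ioi Set.Ioc_subset_Ioi_self ?_).trans ?_
    rotate_left
    · apply setIntegral_congr_fun measurableSet_Ioc
      intro y hy
      have : y ^ 2 ≤ R ^ 2 := pow_le_pow_left₀ hy.1.le hy.2 2
      simp only [smul_eq_mul]
      rw [max_eq_left (by linarith)]
      obtain ⟨j, rfl⟩ : ∃ j, k = j + 1 := ⟨k - 1, by omega⟩
      simp only [Nat.add_sub_cancel]
      ring
    · intro y hy
      have hy1 : R < y := by
        by_contra h
        exact hy.2 ⟨hy.1, not_lt.mp h⟩
      have : R ^ 2 ≤ y ^ 2 := pow_le_pow_left₀ hR hy1.le 2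
      rw [max_eq_right (by linarith)]
      simp
  rw [h1, ← intervalIntegral.integral_of_le hR, intervalIntegral.integral_sub
    (by apply Continuous.intervalIntegrable; fun_prop)
    (by apply Continuous.intervalIntegrable; fun_prop),
    intervalIntegral.integral_const_mul, integral_pow, integral_pow]
  obtain ⟨j, rfl⟩ : ∃ j, k = j + 1 := ⟨k - 1, by omega⟩
  simp only [Nat.add_sub_cancel]
  push_cast
  field_simp
  ring

lemma gA_euclid (k : ℕ) (hk : 1 ≤ k) (R : ℝ) (hR : 0 ≤ R) :
    ∫ x : EuclideanSpace ℝ (Fin k), max (R ^ 2 - ‖x‖ ^ 2) 0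
      = Real.sqrt Real.pi ^ k / Real.Gamma (k / 2 + 1) * R ^ (k + 2) * (2 / (k + 2)) := by
  have : Nonempty (Fin k) := ⟨⟨0, hk⟩⟩
  have : Nontrivial (EuclideanSpace ℝ (Fin k)) := by
    apply Module.nontrivial_of_finrank_pos (R := ℝ)
    simp; omega
  have := integral_fun_norm_addHaar (volume : Measure (EuclideanSpace ℝ (Fin k)))
    (fun y : ℝ => max (R ^ 2 - y ^ 2) 0)
  rw [this]
  simp only [finrank_euclideanSpace, Fintype.card_fin]
  rw [gA_radial k hk R hR, Measure.real, EuclideanSpace.volume_ball]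
  have hG : 0 < Real.Gamma ((k:ℝ) / 2 + 1) := Real.Gamma_pos_of_pos (by positivity)
  simp only [ENNReal.ofReal_one, one_pow, one_mul, Fintype.card_fin]
  rw [ENNReal.toReal_ofReal (by positivity)]
  have : (k:ℝ) ≠ 0 := by positivity
  simp only [smul_eq_mul, nsmul_eq_mul]
  field_simp

lemma gA_int (k : ℕ) (R : ℝ) (c : Fin k → ℝ) :
    Integrable (fun x : Fin k → ℝ => max (R ^ 2 - ∑ j, (x j - c j) ^ 2) 0) := by
  apply Continuous.integrable_of_hasCompactSupport
  · fun_prop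
  · apply HasCompactSupport.intro (K := Metric.closedBall c |R|) (isCompact_closedBall _ _)
    intro x hx
    apply max_eq_right
    by_contra h
    push Not at h
    apply hx
    rw [Metric.mem_closedBall, dist_pi_le_iff (abs_nonneg _)]
    intro j
    rw [Real.dist_eq]
    apply sq_le_sq.mp
    have := Finset.single_le_sum (f := fun j => (x j - c j) ^ 2) (fun i _ => sq_nonneg _)
      (Finset.mem_univ j)
    linarith

lemma gA_pi (k : ℕ) (hk : 1 ≤ k) (R : ℝ) (hR : 0 ≤ R) (c : Fin k → ℝ) :
    ∫ x : Fin k → ℝ, max (R ^ 2 - ∑ j, (x j - c j) ^ 2) 0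
      = Real.sqrt Real.pi ^ k / Real.Gamma (k / 2 + 1) * R ^ (k + 2) * (2 / (k + 2)) := by
  rw [← gA_euclid k hk R hR]
  rw [← integral_sub_right_eq_self (μ := (volume : Measure (Fin k → ℝ)))
    (fun x : Fin k → ℝ => max (R ^ 2 - ∑ j, (x j - c j) ^ 2) 0) (-c)]
  rw [← (PiLp.volume_preserving_toLp (Fin k)).integral_comp
    (MeasurableEquiv.toLp 2 (Fin k → ℝ)).measurableEmbedding]
  simp [EuclideanSpace.norm_sq_eq]

/-- second moment on a unit cube -/
lemma gA_cube (k : ℕ) (p c : Fin k → ℝ) :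
    IntegrableOn (fun x : Fin k → ℝ => ∑ j, (x j - c j) ^ 2)
      (Set.univ.pi fun j => Set.Ico (p j - 1/2) (p j + 1/2)) ∧
    ∫ x in (Set.univ.pi fun j => Set.Ico (p j - 1/2) (p j + 1/2)), ∑ j, (x j - c j) ^ 2
      = ∑ j, ((p j - c j) ^ 2 + 1 / 12) := by
  have hr : (volume : Measure (Fin k → ℝ)).restrict
      (Set.univ.pi fun j => Set.Ico (p j - 1/2) (p j + 1/2)) =
      Measure.pi (fun j => (volume : Measure ℝ).restrict (Set.Ico (p j - 1/2) (p j + 1/2))) := by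
    rw [volume_pi, Measure.restrict_pi_pi]
  have : ∀ j, IsProbabilityMeasure
      ((volume : Measure ℝ).restrict (Set.Ico (p j - 1/2) (p j + 1/2))) := by
    intro j
    constructor
    simp
    norm_num
  have h1 : ∀ j, Integrable (fun x : ℝ => (x - c j) ^ 2)
      ((volume : Measure ℝ).restrict (Set.Ico (p j - 1/2) (p j + 1/2))) := by
    intro j
    apply IntegrableOn.mono_set (t := Set.Icc (p j - 1/2) (p j + 1/2)) _ Set.Ico_subset_Icc_self
    exact (Continuous.continuousOn (by fun_prop)).integrableOn_Icc
  have h2 : ∀ j, Integrable (fun x : Fin k → ℝ => (x j - c j) ^ 2)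
      (Measure.pi (fun j => (volume : Measure ℝ).restrict (Set.Ico (p j - 1/2) (p j + 1/2)))) := by
    intro j
    exact (measurePreserving_eval (fun j => (volume : Measure ℝ).restrict (Set.Ico (p j - 1/2) (p j + 1/2))) j).integrable_comp_of_integrable (h1 j)
  unfold IntegrableOn
  rw [hr]
  refine ⟨integrable_finsetSum _ fun j _ => h2 j, ?_⟩
  rw [integral_finsetSum _ fun j _ => h2 j]
  apply Finset.sum_congr rfl
  intro j _
  have h3 := integral_map (μ := Measure.pi (fun j => (volume : Measure ℝ).restrict (Set.Ico (p j - 1/2) (p j + 1/2)))) (φ := Function.eval j) (measurable_pi_apply j).aemeasurable (f := fun x : ℝ => (x - c j) ^ 2) (by fun_prop)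
  rw [(measurePreserving_eval (fun j => (volume : Measure ℝ).restrict (Set.Ico (p j - 1/2) (p j + 1/2))) j).map_eq] at h3
  simp only [Function.eval] at h3
  rw [← h3, integral_Ico_eq_integral_Ioc, ← intervalIntegral.integral_of_le (by linarith),
    intervalIntegral.integral_comp_sub_right (fun x => x ^ 2), integral_pow]
  push_cast
  ring

lemma gA_main (k : ℕ) (hk : 1 ≤ k) (P : Finset (Fin k → ℤ)) (c : Fin k → ℝ) (R : ℝ) (hR : 0 ≤ R) :
    (P.card : ℝ) * R ^ 2
      - Real.sqrt Real.pi ^ k / Real.Gamma (k / 2 + 1) * R ^ (k + 2) * (2 / (k + 2))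
      ≤ ∑ p ∈ P, ∑ j, (((p j : ℝ) - c j) ^ 2 + 1 / 12) := by
  set Q : (Fin k → ℤ) → Set (Fin k → ℝ) :=
    fun p => Set.univ.pi fun j => Set.Ico ((p j : ℝ) - 1/2) ((p j : ℝ) + 1/2) with hQ
  set g : (Fin k → ℝ) → ℝ := fun x => max (R ^ 2 - ∑ j, (x j - c j) ^ 2) 0 with hg
  have hgi : Integrable g := gA_int k R c
  have hQm : ∀ p, MeasurableSet (Q p) := fun p =>
    MeasurableSet.univ_pi fun j => measurableSet_Ico
  have hvol : ∀ p, volume.real (Q p) = 1 := by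
    intro p
    simp only [hQ, Measure.real, volume_pi_pi, Real.volume_Ico]
    norm_num
  have hfin : ∀ p, volume (Q p) ≠ ⊤ := by
    intro p h
    have := hvol p
    simp [Measure.real, h] at this
  have hdisj : Set.PairwiseDisjoint (P : Set (Fin k → ℤ)) Q := by
    intro p _ q _ hpq
    rw [Function.onFun, Set.disjoint_left]
    intro x hx hy
    apply hpq
    funext j
    have h1 := hx j (Set.mem_univ j)
    have h2 := hy j (Set.mem_univ j)
    have h3 : ((p j : ℝ)) < q j + 1 := by linarith [h1.1, h2.2]
    have h4 : ((q j : ℝ)) < p j + 1 := by linarith [h1.2, h2.1]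
    norm_cast at h3 h4
    omega
  have hsum : ∑ p ∈ P, ∫ x in Q p, g x ≤ ∫ x, g x := by
    rw [← integral_biUnion_finset P (fun p _ => hQm p) hdisj (fun p _ => hgi.integrableOn)]
    exact setIntegral_le_integral hgi (Filter.Eventually.of_forall fun x => le_max_right _ _)
  have hone : ∀ p ∈ P, R ^ 2 - ∫ x in Q p, g x ≤ ∑ j, (((p j : ℝ) - c j) ^ 2 + 1 / 12) := by
    intro p _
    have hc := gA_cube k (fun j => (p j : ℝ)) c
    have e : ∫ x in Q p, (R ^ 2 - g x) = R ^ 2 - ∫ x in Q p, g x := by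
      rw [integral_sub (integrableOn_const (C := R ^ 2) (hfin p)) hgi.integrableOn]
      rw [setIntegral_const, hvol]
      simp
    rw [← e, ← hc.2]
    apply setIntegral_mono
    · exact (integrableOn_const (C := R ^ 2) (hfin p)).sub hgi.integrableOn
    · exact hc.1
    · intro x
      have := le_max_left (R ^ 2 - ∑ j, (x j - c j) ^ 2) 0
      simp only [hg]
      linarith
  have := Finset.sum_le_sum hone
  rw [Finset.sum_sub_distrib] at this
  simp only [Finset.sum_const, nsmul_eq_mul] at this
  rw [← gA_pi k hk R hR c]
  linarith

/-- final form -/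
lemma gA_final (k : ℕ) (hk : 1 ≤ k) (P : Finset (Fin k → ℤ)) (c : Fin k → ℝ) :
    (P.card : ℝ) * ((k : ℝ) * (Real.Gamma ((k : ℝ) / 2 + 1) ^ ((2 : ℝ) / k)
        * (P.card : ℝ) ^ ((2 : ℝ) / k) / (Real.pi * (k + 2)) - 1 / 12))
      ≤ ∑ p ∈ P, ∑ j, ((p j : ℝ) - c j) ^ 2 := by
  have hk0 : (0:ℝ) < k := by positivity
  have hG : 0 < Real.Gamma ((k:ℝ) / 2 + 1) := Real.Gamma_pos_of_pos (by positivity)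
  have hpi := Real.pi_pos
  set N : ℝ := (P.card : ℝ) with hN
  have hN0 : 0 ≤ N := Nat.cast_nonneg _
  set G := Real.Gamma ((k:ℝ) / 2 + 1)
  set R : ℝ := (G * N) ^ ((1 : ℝ) / k) / Real.sqrt Real.pi with hRd
  have hR0 : 0 ≤ R := by positivity
  have hRk : R ^ k * (Real.sqrt Real.pi ^ k / G) = N := by
    rw [hRd, div_pow, ← Real.rpow_natCast ((G * N) ^ ((1 : ℝ) / k)) k, ← Real.rpow_mul (by positivity)]
    rw [one_div, inv_mul_cancel₀ hk0.ne', Real.rpow_one]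
    have : 0 < Real.sqrt Real.pi := Real.sqrt_pos.mpr hpi
    field_simp
  have hR2 : R ^ 2 = G ^ ((2 : ℝ) / k) * N ^ ((2 : ℝ) / k) / Real.pi := by
    rw [hRd, div_pow, Real.sq_sqrt hpi.le, ← Real.rpow_natCast ((G * N) ^ ((1 : ℝ) / k)) 2,
      ← Real.rpow_mul (by positivity), Real.mul_rpow hG.le hN0]
    congr 3 <;> (push_cast; ring_nf)
  have h := gA_main k hk P c R hR0
  rw [pow_add R k 2] at h
  have e : ∑ p ∈ P, ∑ j, (((p j : ℝ) - c j) ^ 2 + 1 / 12)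
      = ∑ p ∈ P, ∑ j, ((p j : ℝ) - c j) ^ 2 + N * k / 12 := by
    simp only [Finset.sum_add_distrib, Finset.sum_const, Finset.card_univ, Fintype.card_fin, nsmul_eq_mul]
    ring
  rw [e] at h
  have e2 : Real.sqrt Real.pi ^ k / G * (R ^ k * R ^ 2) * (2 / (k + 2)) = N * R ^ 2 * (2 / (k + 2)) := by
    rw [← hRk]; ring
  rw [e2] at h
  have e3 : N * ((k : ℝ) * (G ^ ((2 : ℝ) / k)
        * N ^ ((2 : ℝ) / k) / (Real.pi * (k + 2)) - 1 / 12)) = N * R ^ 2 - N * R ^ 2 * (2 / (k + 2)) - N * k / 12 := by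
    rw [hR2]; field_simp; ring
  rw [e3]; linarith
open Finset

lemma gB_telescope (m r d : ℕ) :
    (r + d).choose (m + 1) ≤ r.choose (m + 1) + d * (r + d - 1).choose m := by
  induction d with
  | zero => simp
  | succ d ih =>
    rw [← Nat.add_assoc, Nat.choose_succ_succ, Nat.add_sub_cancel]
    have : (r + d - 1).choose m ≤ (r + d).choose m := Nat.choose_le_choose m (by omega)
    have := Nat.mul_le_mul_left d this
    linarith [Nat.succ_mul d ((r + d).choose m)]

lemma gB_desc (n r m : ℕ) (h : r ≤ n) :
    (r - m).descFactorial m * n.descFactorial m ≤ r.descFactorial m * (n - m).descFactorial m := by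
  simp only [Nat.descFactorial_eq_prod_range]
  rw [← Finset.prod_mul_distrib, ← Finset.prod_mul_distrib]
  apply Finset.prod_le_prod' 
  intro i _
  by_cases hi : r ≤ m + i
  · have : r - m - i = 0 := by omega
    simp [this]
  · obtain ⟨u, rfl⟩ : ∃ u, r = m + i + u := ⟨r - (m + i), by omega⟩
    obtain ⟨v, rfl⟩ : ∃ v, n = m + i + u + v := ⟨n - (m + i + u), by omega⟩
    have e1 : m + i + u - m - i = u := by omega
    have e2 : m + i + u + v - i = m + u + v := by omega
    have e3 : m + i + u - i = m + u := by omega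
    have e4 : m + i + u + v - m - i = u + v := by omega
    rw [e1, e2, e3, e4]
    nlinarith [Nat.zero_le (m * v)]

/-- `C(n-2m,r-2m) C(n,r) ≤ C(n-m,r-m)^2`, in quotient form -/
lemma gB_choose (n r m : ℕ) (h : r ≤ n) (hm : 2 * m ≤ r) :
    (n - 2 * m).choose (r - 2 * m) * n.choose m ^ 2 ≤ n.choose r * r.choose m ^ 2 := by
  have h1 : n.choose r * r.choose m = n.choose m * (n - m).choose (r - m) :=
    Nat.choose_mul (by omega)
  have h2 : (n - m).choose (r - m) * (r - m).choose m
      = (n - m).choose m * (n - 2 * m).choose (r - 2 * m) := by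
    rw [Nat.choose_mul (by omega)]
    congr 2 <;> omega
  have h3 : (r - m).choose m * n.choose m ≤ r.choose m * (n - m).choose m := by
    have := gB_desc n r m h
    simp only [Nat.descFactorial_eq_factorial_mul_choose] at this
    have hf := Nat.factorial_pos m
    apply Nat.le_of_mul_le_mul_left _ (Nat.mul_pos hf hf)
    linarith
  have hp : 0 < (n - m).choose m := Nat.choose_pos (by omega)
  apply Nat.le_of_mul_le_mul_left _ hp
  calc (n - m).choose m * ((n - 2 * m).choose (r - 2 * m) * n.choose m ^ 2)
      = ((n - m).choose m * (n - 2 * m).choose (r - 2 * m)) * n.choose m ^ 2 := by ring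
    _ = (n.choose m * (n - m).choose (r - m)) * ((r - m).choose m * n.choose m) := by
        rw [← h2]; ring
    _ = (n.choose r * r.choose m) * ((r - m).choose m * n.choose m) := by rw [h1]
    _ ≤ (n.choose r * r.choose m) * (r.choose m * (n - m).choose m) := Nat.mul_le_mul_left _ h3
    _ = _ := by ring

lemma gB_cnt_le (n r m : ℕ) (h : r ≤ n) (U : Finset (Fin n)) (hU : U.card = 2 * m) :
    (((univ : Finset (Fin n)).powersetCard r).filter (U ⊆ ·)).card * n.choose m ^ 2
      ≤ n.choose r * r.choose m ^ 2 := by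
  by_cases hr : 2 * m ≤ r
  · rw [Finset.card_filter_powersetCard_subset _ _ _ (by simp) (by omega)]
    simpa [hU] using gB_choose n r m h hr
  · rw [Finset.filter_false_of_mem]
    · simp
    · intro A hA hUA
      have := Finset.card_le_card hUA
      have := (mem_powersetCard.mp hA).2
      omega

lemma gB_cnt (n r m : ℕ) (hr : m ≤ r) (U : Finset (Fin n)) (hU : U.card = m) :
    (((univ : Finset (Fin n)).powersetCard r).filter (U ⊆ ·)).card * n.choose m
      = n.choose r * r.choose m := by
  rw [Finset.card_filter_powersetCard_subset _ _ _ (by simp) (by omega), Nat.choose_mul hr]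
  simp [hU, mul_comm]

/-- number of intersecting pairs -/
lemma gB_inter (n m : ℕ) (hm : 1 ≤ m) (A : Finset (Fin n)) :
    (((A.powersetCard m ×ˢ A.powersetCard m).filter fun p => ¬ Disjoint p.1 p.2).card : ℝ)
      ≤ (A.card : ℝ) ^ (2 * m - 1) / ((m - 1).factorial : ℝ) ^ 2 := by
  obtain ⟨m, rfl⟩ : ∃ q, m = q + 1 := ⟨m - 1, by omega⟩
  have h1 : ((A.powersetCard (m+1) ×ˢ A.powersetCard (m+1)).filter
      fun p => ¬ Disjoint p.1 p.2).card
      ≤ A.card.choose (m+1) * ((m+1) * (A.card - 1).choose m) := by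
    rw [Finset.card_filter, Finset.sum_product]
    rw [← Finset.card_powersetCard, ← smul_eq_mul]
    apply Finset.sum_le_card_nsmul
    intro S hS
    have hS' := mem_powersetCard.mp hS
    rw [← Finset.card_filter]
    have e := Finset.card_filter_add_card_filter_not (s := A.powersetCard (m+1)) (fun T => Disjoint S T)
    have e2 : (A.powersetCard (m+1)).filter (fun T => Disjoint S T) = (A \ S).powersetCard (m+1) := by
      ext T
      simp only [mem_filter, mem_powersetCard, Finset.subset_sdiff]
      rw [disjoint_comm]
      tauto
    rw [e2, card_powersetCard, card_powersetCard, card_sdiff_of_subset hS'.1, hS'.2] at e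
    have hc := Finset.card_le_card hS'.1
    have := gB_telescope m (A.card - (m+1)) (m+1)
    rw [Nat.sub_add_cancel (by omega)] at this
    dsimp only
    omega
  calc _ ≤ ((A.card.choose (m+1) * ((m+1) * (A.card - 1).choose m) : ℕ) : ℝ) := by exact_mod_cast h1
    _ ≤ ((A.card : ℝ) ^ (m+1) / (m+1).factorial) * ((m+1) * ((A.card : ℝ) ^ m / m.factorial)) := by
      push_cast
      gcongr
      · exact Nat.choose_le_pow_div _ _
      · refine le_trans ?_ (Nat.choose_le_pow_div _ _)
        exact_mod_cast Nat.choose_le_choose m (by omega)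
    _ = _ := by
      have : 2 * (m + 1) - 1 = m + 1 + m := by omega
      rw [this, Nat.factorial_succ, pow_add]
      push_cast
      field_simp
      ring

/-- real-valued evaluation -/
noncomputable def evR (n m : ℕ) (b : Fin n → ℝ) (A : Finset (Fin n)) : ℝ :=
  ∑ S ∈ A.powersetCard m, ∏ i ∈ S, b i

lemma gB_first (n m r : ℕ) (hr : m ≤ r) (b : Fin n → ℝ) :
    (∑ A ∈ (univ : Finset (Fin n)).powersetCard r, evR n m b A) * n.choose m
      = n.choose r * r.choose m * evR n m b univ := by
  have e : ∀ A : Finset (Fin n), evR n m b A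
      = ∑ S ∈ (univ : Finset (Fin n)).powersetCard m, if S ⊆ A then ∏ i ∈ S, b i else 0 := by
    intro A
    rw [← Finset.sum_filter, evR]
    apply Finset.sum_congr _ (fun _ _ => rfl)
    ext S; simp [mem_powersetCard, and_comm]
  rw [Finset.sum_congr rfl fun A _ => e A, Finset.sum_comm, evR, Finset.sum_mul, Finset.mul_sum]
  apply Finset.sum_congr rfl
  intro S hS
  rw [← Finset.sum_filter, Finset.sum_const, nsmul_eq_mul]
  have := gB_cnt n r m hr S (mem_powersetCard.mp hS).2
  have : ((((univ : Finset (Fin n)).powersetCard r).filter (S ⊆ ·)).card : ℝ) * n.choose m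
      = n.choose r * r.choose m := by exact_mod_cast this
  rw [← this]; ring

lemma gB_second (n m r : ℕ) (hm : 1 ≤ m) (hrn : r ≤ n) (b : Fin n → ℝ) (M : ℝ)
    (hb : ∀ i, 0 ≤ b i ∧ b i ≤ M) :
    (∑ A ∈ (univ : Finset (Fin n)).powersetCard r, evR n m b A ^ 2) * (n.choose m : ℝ) ^ 2
      ≤ n.choose r * (r.choose m : ℝ) ^ 2 * evR n m b univ ^ 2
        + n.choose r * (M ^ (2 * m) * ((r : ℝ) ^ (2 * m - 1) / ((m - 1).factorial : ℝ) ^ 2))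
          * (n.choose m : ℝ) ^ 2 := by
  set w : Finset (Fin n) → ℝ := fun S => ∏ i ∈ S, b i with hw
  have hw0 : ∀ S, 0 ≤ w S := fun S => Finset.prod_nonneg fun i _ => (hb i).1
  have hwM : ∀ S, S.card = m → w S ≤ M ^ m := by
    intro S hS
    rw [← hS, ← Finset.prod_const]
    exact Finset.prod_le_prod (fun i _ => (hb i).1) (fun i _ => (hb i).2)
  set D : Finset (Fin n) → ℝ := fun A =>
    ∑ p ∈ (A.powersetCard m ×ˢ A.powersetCard m).filter (fun p => Disjoint p.1 p.2), w p.1 * w p.2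
  have hpt : ∀ A ∈ (univ : Finset (Fin n)).powersetCard r, evR n m b A ^ 2 ≤ D A +
      M ^ (2 * m) * ((r : ℝ) ^ (2 * m - 1) / ((m - 1).factorial : ℝ) ^ 2) := by
    intro A hA
    have hA' := (mem_powersetCard.mp hA).2
    have e1 : evR n m b A ^ 2 = ∑ p ∈ A.powersetCard m ×ˢ A.powersetCard m, w p.1 * w p.2 := by
      rw [sq, evR, Finset.sum_mul_sum, Finset.sum_product]
    rw [e1, ← Finset.sum_filter_add_sum_filter_not _ (fun p => Disjoint p.1 p.2)]
    gcongr
    have hI := gB_inter n m hm A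
    rw [hA'] at hI
    calc _ ≤ (((A.powersetCard m ×ˢ A.powersetCard m).filter fun p => ¬ Disjoint p.1 p.2).card)
          • (M ^ (2 * m)) := by
          apply Finset.sum_le_card_nsmul
          intro p hp
          simp only [mem_filter, mem_product, mem_powersetCard] at hp
          rw [two_mul, pow_add]
          have := hwM p.1 hp.1.1.2
          exact mul_le_mul this (hwM p.2 hp.1.2.2) (hw0 _) ((hw0 _).trans this)
      _ ≤ _ := by
          rw [nsmul_eq_mul, mul_comm]
          apply mul_le_mul_of_nonneg_left hI
          rw [mul_comm, pow_mul]; positivity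
  have hD : (∑ A ∈ (univ : Finset (Fin n)).powersetCard r, D A) * (n.choose m : ℝ) ^ 2
      ≤ n.choose r * (r.choose m : ℝ) ^ 2 * evR n m b univ ^ 2 := by
    have e : ∀ A : Finset (Fin n), D A
      = ∑ p ∈ ((univ : Finset (Fin n)).powersetCard m ×ˢ (univ : Finset (Fin n)).powersetCard m).filter (fun p => Disjoint p.1 p.2), if p.1 ∪ p.2 ⊆ A then w p.1 * w p.2 else 0 := by
      intro A
      rw [← Finset.sum_filter]
      apply Finset.sum_congr _ (fun _ _ => rfl)
      ext S; simp [mem_powersetCard, Finset.union_subset_iff]; tauto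
    rw [Finset.sum_congr rfl fun A _ => e A, Finset.sum_comm, Finset.sum_mul]
    have e1 : evR n m b univ ^ 2 = ∑ p ∈ (univ : Finset (Fin n)).powersetCard m ×ˢ (univ : Finset (Fin n)).powersetCard m, w p.1 * w p.2 := by
      rw [sq, evR, Finset.sum_mul_sum, Finset.sum_product]
    rw [e1, Finset.mul_sum]
    refine le_trans ?_ (Finset.sum_le_sum_of_subset_of_nonneg (Finset.filter_subset (fun p => Disjoint p.1 p.2) _) ?_)
    · apply Finset.sum_le_sum
      intro p hp
      simp only [mem_filter, mem_product, mem_powersetCard] at hp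
      rw [← Finset.sum_filter, Finset.sum_const, nsmul_eq_mul]
      have := gB_cnt_le n r m hrn (p.1 ∪ p.2) (by
        rw [Finset.card_union_of_disjoint hp.2]; omega)
      have : ((((univ : Finset (Fin n)).powersetCard r).filter (p.1 ∪ p.2 ⊆ ·)).card : ℝ) * (n.choose m : ℝ) ^ 2
        ≤ n.choose r * (r.choose m : ℝ) ^ 2 := by exact_mod_cast this
      have := mul_le_mul_of_nonneg_right this (mul_nonneg (hw0 p.1) (hw0 p.2))
      linarith
    · intro p _ _
      have := mul_nonneg (hw0 p.1) (hw0 p.2)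
      positivity
  have h1 := Finset.sum_le_sum hpt
  rw [Finset.sum_add_distrib, Finset.sum_const, nsmul_eq_mul, card_powersetCard, card_univ, Fintype.card_fin] at h1
  have := mul_le_mul_of_nonneg_right h1 (sq_nonneg (n.choose m : ℝ))
  linarith

/-- second moment on the slice `r` about the mean of slice `s` -/
lemma gB_main (n m r s : ℕ) (hm : 1 ≤ m) (hmr : m ≤ r) (hrs : r ≤ s) (hsn : s ≤ n) (b : Fin n → ℝ)
    (M : ℝ) (hM : 0 ≤ M) (hb : ∀ i, 0 ≤ b i ∧ b i ≤ M) :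
    ∑ A ∈ (univ : Finset (Fin n)).powersetCard r,
      (evR n m b A - evR n m b univ * s.choose m / n.choose m) ^ 2
      ≤ n.choose r * (M ^ (2 * m) * (((s : ℝ) ^ (2 * m - 1)
          + ((s - r : ℕ) : ℝ) ^ 2 * (s : ℝ) ^ (2 * m - 2)) / ((m - 1).factorial : ℝ) ^ 2)) := by
  have hc : (0 : ℝ) < n.choose m := by exact_mod_cast Nat.choose_pos (by omega)
  have h1 := gB_first n m r hmr b
  have h2 := gB_second n m r hm (hrs.trans hsn) b M hb
  set E := evR n m b univ
  set q : ℝ := (n.choose m : ℝ)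
  have hE : 0 ≤ E / q ∧ E / q ≤ M ^ m := by
    constructor
    · refine div_nonneg (Finset.sum_nonneg fun S _ => Finset.prod_nonneg fun i _ => (hb i).1) hc.le
    · rw [div_le_iff₀ hc]
      have : E ≤ ((univ : Finset (Fin n)).powersetCard m).card • M ^ m := by
        apply Finset.sum_le_card_nsmul
        intro S hS
        rw [← (mem_powersetCard.mp hS).2, ← Finset.prod_const]
        exact Finset.prod_le_prod (fun i _ => (hb i).1) (fun i _ => (hb i).2)
      simp only [card_powersetCard, card_univ, Fintype.card_fin, nsmul_eq_mul] at this
      linarith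
  have h1' : ∑ A ∈ (univ : Finset (Fin n)).powersetCard r, evR n m b A
      = n.choose r * r.choose m * (E / q) := by
    rw [← mul_div_assoc, ← h1]; field_simp
  have h2' : ∑ A ∈ (univ : Finset (Fin n)).powersetCard r, evR n m b A ^ 2 ≤
      n.choose r * ((r.choose m : ℝ) ^ 2 * (E / q) ^ 2)
        + n.choose r * (M ^ (2 * m) * ((r : ℝ) ^ (2 * m - 1) / ((m - 1).factorial : ℝ) ^ 2)) := by
    have hq2 : 0 < q ^ 2 := by positivity
    apply le_of_mul_le_mul_right _ hq2
    refine h2.trans (le_of_eq ?_)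
    field_simp
  have e : ∑ A ∈ (univ : Finset (Fin n)).powersetCard r, (evR n m b A - E * s.choose m / q) ^ 2
      = ∑ A ∈ (univ : Finset (Fin n)).powersetCard r, evR n m b A ^ 2
        - 2 * (E / q * s.choose m) * ∑ A ∈ (univ : Finset (Fin n)).powersetCard r, evR n m b A
        + n.choose r * (E / q * s.choose m) ^ 2 := by
    rw [Finset.mul_sum, ← Finset.sum_sub_distrib]
    have : (n.choose r : ℝ) * (E / q * s.choose m) ^ 2 = ∑ A ∈ (univ : Finset (Fin n)).powersetCard r, (E / q * s.choose m) ^ 2 := by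
      simp [Finset.sum_const]
    rw [this, ← Finset.sum_add_distrib]
    apply Finset.sum_congr rfl
    intro A _
    ring
  rw [e, h1']
  have hd0 : (r.choose m : ℝ) ≤ s.choose m := by exact_mod_cast Nat.choose_le_choose m hrs
  have hd1 : (s.choose m : ℝ) - r.choose m ≤ ((s - r : ℕ) : ℝ) * ((s : ℝ) ^ (m - 1) / (m - 1).factorial) := by
    obtain ⟨m, rfl⟩ : ∃ q, m = q + 1 := ⟨m - 1, by omega⟩
    have := gB_telescope m r (s - r)
    rw [Nat.add_sub_cancel' hrs] at this
    have h3 : (s.choose (m+1) : ℝ) ≤ r.choose (m+1) + ((s - r : ℕ) : ℝ) * (s - 1).choose m := by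
      exact_mod_cast this
    have h4 : (((s - 1).choose m : ℕ) : ℝ) ≤ (s : ℝ) ^ m / m.factorial := by
      refine le_trans ?_ (Nat.choose_le_pow_div _ _)
      exact_mod_cast Nat.choose_le_choose m (by omega)
    have h5 := mul_le_mul_of_nonneg_left h4 (Nat.cast_nonneg (α := ℝ) (s - r))
    simp only [Nat.add_sub_cancel]
    linarith
  have hd2 : (E / q * (s.choose m - r.choose m)) ^ 2 ≤
      M ^ (2 * m) * (((s - r : ℕ) : ℝ) ^ 2 * (s : ℝ) ^ (2 * m - 2) / ((m - 1).factorial : ℝ) ^ 2) := by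
    have : E / q * (s.choose m - r.choose m) ≤ M ^ m * (((s - r : ℕ) : ℝ) * ((s : ℝ) ^ (m - 1) / (m - 1).factorial)) :=
      mul_le_mul hE.2 hd1 (by linarith) (by positivity)
    refine (pow_le_pow_left₀ (mul_nonneg hE.1 (by linarith)) this 2).trans (le_of_eq ?_)
    have e2 : 2 * m - 2 = (m - 1) * 2 := by omega
    rw [e2, pow_mul (s : ℝ), mul_comm 2 m, pow_mul]
    ring
  have hd3 : M ^ (2 * m) * ((r : ℝ) ^ (2 * m - 1) / ((m - 1).factorial : ℝ) ^ 2)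
      ≤ M ^ (2 * m) * ((s : ℝ) ^ (2 * m - 1) / ((m - 1).factorial : ℝ) ^ 2) := by
    gcongr
  have hn0 : (0 : ℝ) ≤ n.choose r := Nat.cast_nonneg _
  have hd4 := mul_le_mul_of_nonneg_left (add_le_add hd3 hd2) hn0
  have e5 : n.choose r * (M ^ (2 * m) * (((s : ℝ) ^ (2 * m - 1)
          + ((s - r : ℕ) : ℝ) ^ 2 * (s : ℝ) ^ (2 * m - 2)) / ((m - 1).factorial : ℝ) ^ 2))
     = n.choose r * (M ^ (2 * m) * ((s : ℝ) ^ (2 * m - 1) / ((m - 1).factorial : ℝ) ^ 2) + M ^ (2 * m) * (((s - r : ℕ) : ℝ) ^ 2 * (s : ℝ) ^ (2 * m - 2) / ((m - 1).factorial : ℝ) ^ 2)) := by ring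
  rw [e5]
  refine le_trans ?_ hd4
  rw [mul_add]
  nlinarith [h2']
open Filter in
lemma gC_ratio (n r : ℕ) (l : ℝ) (hl0 : 0 < l) (hl : l < 1 / 2) (hn : 1 ≤ n)
    (hr : ((r + 1 : ℕ) : ℝ) ≤ l * n) :
    (n.choose r : ℝ) ≤ l / (1 - l) * n.choose (r + 1) := by
  have hn0 : (0 : ℝ) < n := by exact_mod_cast hn
  have hrn : r ≤ n := by
    have : ((r + 1 : ℕ) : ℝ) ≤ (n : ℝ) := hr.trans (by nlinarith)
    have : r + 1 ≤ n := by exact_mod_cast this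
    omega
  have h1 : (n.choose (r + 1) : ℝ) * ((r + 1 : ℕ) : ℝ) = n.choose r * ((n : ℝ) - r) := by
    have := Nat.choose_succ_right_eq n r
    rw [← Nat.cast_sub hrn]
    exact_mod_cast this
  have h2 : (1 - l) * n ≤ (n : ℝ) - r := by
    push_cast at hr
    nlinarith
  have a0 : (0 : ℝ) ≤ n.choose r := Nat.cast_nonneg _
  have b0 : (0 : ℝ) ≤ n.choose (r + 1) := Nat.cast_nonneg _
  have h3 : (n.choose r : ℝ) * ((1 - l) * n) ≤ n.choose (r + 1) * (l * n) :=
    (mul_le_mul_of_nonneg_left h2 a0).trans (h1 ▸ mul_le_mul_of_nonneg_left hr b0)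
  rw [div_mul_eq_mul_div, le_div_iff₀ (by linarith)]
  apply le_of_mul_le_mul_right _ hn0
  linarith

lemma gC_tail (n s : ℕ) (l : ℝ) (hl0 : 0 < l) (hl : l < 1 / 2) (hn : 1 ≤ n)
    (hs : (s : ℝ) ≤ l * n) (t : ℕ) (ht : t ≤ s + 1) :
    (∑ r ∈ range (s + 1 - t), (n.choose r : ℝ))
      ≤ (l / (1 - l)) ^ t * ∑ r ∈ range (s + 1), (n.choose r : ℝ) := by
  have hρ : 0 ≤ l / (1 - l) := div_nonneg hl0.le (by linarith)
  induction t with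
  | zero => simp
  | succ t ih =>
    have ih := ih (by omega)
    have hstep : (∑ r ∈ range (s + 1 - (t + 1)), (n.choose r : ℝ))
        ≤ l / (1 - l) * ∑ r ∈ range (s + 1 - t), (n.choose r : ℝ) := by
      have e : s + 1 - t = (s + 1 - (t + 1)) + 1 := by omega
      rw [e, Finset.sum_range_succ', mul_add, Finset.mul_sum]
      have : ∑ r ∈ range (s + 1 - (t + 1)), (n.choose r : ℝ)
          ≤ ∑ r ∈ range (s + 1 - (t + 1)), l / (1 - l) * (n.choose (r + 1) : ℝ) := by
        apply Finset.sum_le_sum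
        intro r hr
        have hr := Finset.mem_range.mp hr
        apply gC_ratio n r l hl0 hl hn
        refine le_trans ?_ hs
        exact_mod_cast (by omega : r + 1 ≤ s)
      have h0 : 0 ≤ l / (1 - l) * (n.choose 0 : ℝ) := mul_nonneg hρ (Nat.cast_nonneg _)
      linarith
    rw [pow_succ', mul_assoc]
    exact hstep.trans (mul_le_mul_of_nonneg_left ih hρ)

/-- sets with size in `[u,v)` -/
def slab (n u v : ℕ) : Finset (Finset (Fin n)) :=
  (Finset.Ico u v).biUnion fun r => (univ : Finset (Fin n)).powersetCard r

lemma slab_disj (n u v : ℕ) : Set.PairwiseDisjoint (Finset.Ico u v : Set ℕ)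
    (fun r => (univ : Finset (Fin n)).powersetCard r) := by
  intro i _ j _ hij
  exact Finset.pairwise_disjoint_powersetCard _ hij

lemma mem_slab (n u v : ℕ) (A : Finset (Fin n)) : A ∈ slab n u v ↔ u ≤ A.card ∧ A.card < v := by
  simp [slab, mem_powersetCard]

lemma slab_card (n u v : ℕ) : (slab n u v).card = ∑ r ∈ Finset.Ico u v, n.choose r := by
  rw [slab, Finset.card_biUnion (slab_disj n u v)]
  simp

lemma slab_sum (n u v : ℕ) (f : Finset (Fin n) → ℝ) : ∑ A ∈ slab n u v, f A
    = ∑ r ∈ Finset.Ico u v, ∑ A ∈ (univ : Finset (Fin n)).powersetCard r, f A :=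
  Finset.sum_biUnion (slab_disj n u v)

lemma fam_eq (n : ℕ) (l : ℝ) (hl0 : 0 < l) : Fam n l = slab n 0 (⌊l * n⌋₊ + 1) := by
  ext A
  rw [mem_slab, Fam, mem_filter]
  simp only [mem_univ, true_and, zero_le, Nat.lt_add_one_iff]
  rw [Nat.le_floor_iff (by positivity)]

lemma gC_slab_ge (n t : ℕ) (l : ℝ) (hl0 : 0 < l) (hl : l < 1 / 2) (hn : 1 ≤ n)
    (ht : t ≤ ⌊l * n⌋₊ + 1) (hρ : (l / (1 - l)) ^ t ≤ 1 / 8) :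
    7 / 8 * ((Fam n l).card : ℝ) ≤ ((slab n (⌊l * n⌋₊ + 1 - t) (⌊l * n⌋₊ + 1)).card : ℝ) := by
  set s := ⌊l * n⌋₊
  have h := gC_tail n s l hl0 hl hn (Nat.floor_le (by positivity)) t ht
  rw [fam_eq n l hl0, slab_card, slab_card]
  push_cast
  rw [Nat.Ico_zero_eq_range, Finset.sum_Ico_eq_sub _ (by omega : s + 1 - t ≤ s + 1)]
  have h0 : 0 ≤ ∑ r ∈ range (s + 1), (n.choose r : ℝ) := Finset.sum_nonneg fun _ _ => Nat.cast_nonneg _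
  have := mul_le_mul_of_nonneg_right hρ h0
  linarith

lemma fam_ge (n : ℕ) (l : ℝ) (hl0 : 0 < l) (hs : 1 ≤ ⌊l * n⌋₊) : (n : ℝ) ≤ ((Fam n l).card : ℝ) := by
  rw [fam_eq n l hl0, slab_card]
  have := Finset.single_le_sum (f := fun r => n.choose r) (fun i _ => Nat.zero_le _)
    (Finset.mem_Ico.mpr ⟨Nat.zero_le 1, by omega⟩ : 1 ∈ Finset.Ico 0 (⌊l * n⌋₊ + 1))
  simp only [Nat.choose_one_right] at this
  exact_mod_cast this

/-- The variance comparison on a slab. -/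
lemma gC_compare (n k m s t : ℕ) (hk : 1 ≤ k) (hm : 1 ≤ m) (hsn : s ≤ n) (ht : m + t ≤ s + 1)
    (ht1 : 1 ≤ t) (M : ℤ) (hM : 0 ≤ M) (a : Fin n → Fin k → ℤ)
    (ha : ∀ i j, 0 ≤ a i j ∧ a i j ≤ M)
    (hinj : Set.InjOn (mthEvalVec n k m a) (slab n (s + 1 - t) (s + 1) : Set (Finset (Fin n)))) :
    Real.Gamma ((k : ℝ) / 2 + 1) ^ ((2 : ℝ) / k)
        * ((slab n (s + 1 - t) (s + 1)).card : ℝ) ^ ((2 : ℝ) / k) / (Real.pi * (k + 2)) - 1 / 12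
      ≤ (M : ℝ) ^ (2 * m) * (((s : ℝ) ^ (2 * m - 1)
          + (t : ℝ) ^ 2 * (s : ℝ) ^ (2 * m - 2)) / ((m - 1).factorial : ℝ) ^ 2) := by
  set F := slab n (s + 1 - t) (s + 1) with hF
  set b : Fin k → Fin n → ℝ := fun j i => (a i j : ℝ)
  have hM' : (0 : ℝ) ≤ M := by exact_mod_cast hM
  have hb : ∀ j i, 0 ≤ b j i ∧ b j i ≤ M := by
    intro j i
    exact ⟨Int.cast_nonneg (ha i j).1, Int.cast_le.mpr (ha i j).2⟩
  set c : Fin k → ℝ := fun j => evR n m (b j) univ * s.choose m / n.choose m with hc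
  set B := (M : ℝ) ^ (2 * m) * (((s : ℝ) ^ (2 * m - 1)
          + (t : ℝ) ^ 2 * (s : ℝ) ^ (2 * m - 2)) / ((m - 1).factorial : ℝ) ^ 2) with hB
  have hlow := gA_final k hk (F.image (mthEvalVec n k m a)) c
  rw [Finset.card_image_of_injOn hinj, Finset.sum_image hinj] at hlow
  have hev : ∀ A j, ((mthEvalVec n k m a A j : ℤ) : ℝ) = evR n m (b j) A := by
    intro A j
    simp [mthEvalVec, evR, b]
  simp only [hev] at hlow
  rw [Finset.sum_comm] at hlow
  have hup : ∀ j ∈ (univ : Finset (Fin k)), ∑ A ∈ F, (evR n m (b j) A - c j) ^ 2 ≤ F.card * B := by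
    intro j _
    rw [hF, slab_sum, slab_card]
    push_cast
    rw [Finset.sum_mul]
    apply Finset.sum_le_sum
    intro r hr
    have hr := Finset.mem_Ico.mp hr
    refine (gB_main n m r s hm (by omega) (by omega) hsn (b j) M hM' (hb j)).trans ?_
    have : s - r ≤ t := by omega
    rw [hB]
    gcongr
  have hup2 := Finset.sum_le_sum hup
  simp only [Finset.sum_const, card_univ, Fintype.card_fin, nsmul_eq_mul] at hup2
  have hFpos : 0 < F.card := by
    rw [hF, slab_card]
    apply Finset.sum_pos
    · intro r hr
      have hr := Finset.mem_Ico.mp hr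
      exact Nat.choose_pos (by omega)
    · exact ⟨s, Finset.mem_Ico.mpr ⟨by omega, by omega⟩⟩
  have hFpos' : (0 : ℝ) < F.card := by exact_mod_cast hFpos
  have hk' : (0 : ℝ) < k := by exact_mod_cast hk
  apply le_of_mul_le_mul_left _ (mul_pos hFpos' hk')
  have := hlow.trans hup2
  linarith

theorem stmt9 (k m : ℕ) (hk : 1 ≤ k) (hm : 1 ≤ m) (l : ℝ) (hl0 : 0 < l) (hl : l < 1 / 2)
    (ε : ℝ) (hε : 0 < ε) :
    ∃ n₀ : ℕ, ∀ n : ℕ, n₀ ≤ n → ∀ M : ℤ, ∀ a : Fin n → Fin k → ℤ,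
      (∀ i j, 0 ≤ a i j ∧ a i j ≤ M) →
      (∀ A₁ A₂ : Finset (Fin n), A₁ ∈ Fam n l → A₂ ∈ Fam n l → A₁ ≠ A₂ →
        m ≤ A₁.card → m ≤ A₂.card → mthEvalVec n k m a A₁ ≠ mthEvalVec n k m a A₂) →
      (M : ℝ) ^ (2 * m) ≥ (1 - ε) *
        ((((m - 1).factorial : ℝ)) ^ 2 * Real.Gamma ((k : ℝ) / 2 + 1) ^ ((2 : ℝ) / k) /
          (2 * (l ^ (2 * m - 1) + l ^ (2 * m)) * Real.pi * ((k : ℝ) + 2))) *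
        (((Fam n l).card : ℝ)) ^ ((2 : ℝ) / k) / (n : ℝ) ^ (2 * m - 1) := by
  have hk' : (0 : ℝ) < k := by exact_mod_cast hk
  have hG : 0 < Real.Gamma ((k:ℝ) / 2 + 1) := Real.Gamma_pos_of_pos (by positivity)
  have hpi := Real.pi_pos
  set G := Real.Gamma ((k:ℝ) / 2 + 1) ^ ((2 : ℝ) / k) with hGd
  have hG0 : 0 < G := Real.rpow_pos_of_pos hG _
  set K : ℝ := G / (Real.pi * (k + 2)) with hK
  have hK0 : 0 < K := by positivity
  -- choice of t
  obtain ⟨t₀, ht₀⟩ := exists_pow_lt_of_lt_one (by norm_num : (0:ℝ) < 1 / 8)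
    (show l / (1 - l) < 1 by rw [div_lt_one (by linarith)]; linarith)
  have hρ0 : 0 ≤ l / (1 - l) := div_nonneg hl0.le (by linarith)
  have hρ1 : l / (1 - l) ≤ 1 := by rw [div_le_one (by linarith)]; linarith
  obtain ⟨t, ht1, hρ⟩ : ∃ t : ℕ, 1 ≤ t ∧ (l / (1 - l)) ^ t ≤ 1 / 8 :=
    ⟨t₀ + 1, by omega, (pow_le_pow_of_le_one hρ0 hρ1 (by omega)).trans ht₀.le⟩
  -- eventual conditions
  have hcast : Filter.Tendsto (fun n : ℕ => (n : ℝ)) Filter.atTop Filter.atTop :=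
    tendsto_natCast_atTop_atTop
  have ev1 : ∀ᶠ n : ℕ in Filter.atTop, m + t + 2 * t ^ 2 ≤ ⌊l * n⌋₊ :=
    (tendsto_nat_floor_atTop.comp (hcast.const_mul_atTop hl0)).eventually_ge_atTop _
  have ev2 : ∀ᶠ n : ℕ in Filter.atTop, 16 / 3 ≤ K * (n : ℝ) ^ ((2 : ℝ) / k) :=
    (((tendsto_rpow_atTop (by positivity : (0:ℝ) < 2 / k)).comp hcast).const_mul_atTop
      hK0).eventually_ge_atTop _
  obtain ⟨n₀, hn₀⟩ := Filter.eventually_atTop.mp (ev1.and ev2)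
  refine ⟨max n₀ 1, fun n hn M a ha hdist => ?_⟩
  obtain ⟨h1, h2⟩ := hn₀ n ((le_max_left _ _).trans hn)
  have hn1 : 1 ≤ n := (le_max_right _ _).trans hn
  have hn0 : (0 : ℝ) < n := by exact_mod_cast hn1
  have hM : 0 ≤ M := (ha ⟨0, hn1⟩ ⟨0, hk⟩).1.trans (ha ⟨0, hn1⟩ ⟨0, hk⟩).2
  have hM' : (0 : ℝ) ≤ M := by exact_mod_cast hM
  set s := ⌊l * n⌋₊ with hs
  have hsl : (s : ℝ) ≤ l * n := Nat.floor_le (by positivity)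
  have hsn : s ≤ n := by
    have : (s : ℝ) ≤ n := hsl.trans (by nlinarith)
    exact_mod_cast this
  have hinj : Set.InjOn (mthEvalVec n k m a)
      (slab n (s + 1 - t) (s + 1) : Set (Finset (Fin n))) := by
    intro A hA A' hA' h
    have hA := (mem_slab _ _ _ _).mp (Finset.mem_coe.mp hA)
    have hA' := (mem_slab _ _ _ _).mp (Finset.mem_coe.mp hA')
    by_contra hne
    refine hdist A A' ?_ ?_ hne (by omega) (by omega) h
    · rw [fam_eq n l hl0, mem_slab]; exact ⟨Nat.zero_le _, hA.2⟩
    · rw [fam_eq n l hl0, mem_slab]; exact ⟨Nat.zero_le _, hA'.2⟩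
  have hcmp := gC_compare n k m s t hk hm hsn (by omega) ht1 M hM a ha hinj
  have hge := gC_slab_ge n t l hl0 hl hn1 (by omega) hρ
  have hNn := fam_ge n l hl0 (by omega)
  rw [← hs] at hge
  set N : ℝ := ((Fam n l).card : ℝ)
  set N' : ℝ := ((slab n (s + 1 - t) (s + 1)).card : ℝ)
  have hN0 : 0 ≤ N := Nat.cast_nonneg _
  set x : ℝ := (2 : ℝ) / k with hx
  have hx0 : 0 < x := by positivity
  have hx2 : x ≤ 2 := by
    rw [hx, div_le_iff₀ hk']
    have : (1 : ℝ) ≤ k := by exact_mod_cast hk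
    linarith
  have hpow : 49 / 64 * N ^ x ≤ N' ^ x := by
    have e1 : (49 / 64 : ℝ) ≤ (7 / 8 : ℝ) ^ x := by
      have := Real.rpow_le_rpow_of_exponent_ge (by norm_num : (0:ℝ) < 7 / 8) (by norm_num) hx2
      refine le_trans (le_of_eq ?_) this
      rw [Real.rpow_two]; norm_num
    calc 49 / 64 * N ^ x ≤ (7 / 8 : ℝ) ^ x * N ^ x := by gcongr
      _ = (7 / 8 * N) ^ x := (Real.mul_rpow (by norm_num) hN0).symm
      _ ≤ N' ^ x := by gcongr
  have hbig : 16 / 3 ≤ K * N ^ x := h2.trans (by gcongr)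
  have hlow : 3 / 4 * (K * N ^ x) ≤ G * N' ^ x / (Real.pi * (k + 2)) - 1 / 12 := by
    have : G * N' ^ x / (Real.pi * (k + 2)) = K * N' ^ x := by rw [hK]; ring
    rw [this]
    have := mul_le_mul_of_nonneg_left hpow hK0.le
    linarith
  have hf : (0 : ℝ) < ((m - 1).factorial : ℝ) := by exact_mod_cast Nat.factorial_pos _
  set f : ℝ := ((m - 1).factorial : ℝ)
  have hup : (M : ℝ) ^ (2 * m) * (((s : ℝ) ^ (2 * m - 1)
          + (t : ℝ) ^ 2 * (s : ℝ) ^ (2 * m - 2)) / f ^ 2)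
      ≤ (M : ℝ) ^ (2 * m) * ((3 / 2 * (l * n) ^ (2 * m - 1)) / f ^ 2) := by
    have e1 : (t : ℝ) ^ 2 ≤ s / 2 := by
      have : 2 * t ^ 2 ≤ s := by omega
      have : (2 : ℝ) * (t : ℝ) ^ 2 ≤ s := by exact_mod_cast this
      linarith
    have e2 : (s : ℝ) ^ (2 * m - 1) = s ^ (2 * m - 2) * s := by
      rw [← pow_succ]; congr 1; omega
    have e3 : (t : ℝ) ^ 2 * (s : ℝ) ^ (2 * m - 2) ≤ 1 / 2 * (s : ℝ) ^ (2 * m - 1) := by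
      have := mul_le_mul_of_nonneg_right e1 (by positivity : (0:ℝ) ≤ (s : ℝ) ^ (2 * m - 2))
      rw [e2]; linarith
    have e4 : (s : ℝ) ^ (2 * m - 1) ≤ (l * n) ^ (2 * m - 1) := by gcongr
    gcongr
    linarith
  have hfin : 3 / 4 * (K * N ^ x) ≤ (M : ℝ) ^ (2 * m) * ((3 / 2 * (l * n) ^ (2 * m - 1)) / f ^ 2) :=
    hlow.trans (hcmp.trans hup)
  have hNx : 0 ≤ N ^ x := by positivity
  have hkey : K * N ^ x * f ^ 2 / (2 * l ^ (2 * m - 1) * n ^ (2 * m - 1)) ≤ (M : ℝ) ^ (2 * m) := by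
    rw [div_le_iff₀ (by positivity)]
    have := mul_le_mul_of_nonneg_right hfin (by positivity : (0:ℝ) ≤ f ^ 2)
    rw [mul_assoc ((M : ℝ) ^ (2 * m)), div_mul_cancel₀ _ (by positivity), mul_pow] at this
    linarith
  refine le_trans ?_ hkey
  set Y : ℝ := f ^ 2 * G / (2 * (l ^ (2 * m - 1) + l ^ (2 * m)) * Real.pi * ((k : ℝ) + 2)) with hY
  have hY0 : 0 ≤ Y := by positivity
  have hY1 : Y ≤ f ^ 2 * G / (2 * l ^ (2 * m - 1) * Real.pi * ((k : ℝ) + 2)) := by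
    rw [hY]
    gcongr
    have : 0 < l ^ (2 * m) := by positivity
    linarith
  calc (1 - ε) * Y * N ^ x / (n : ℝ) ^ (2 * m - 1)
      ≤ 1 * Y * N ^ x / (n : ℝ) ^ (2 * m - 1) := by
        gcongr
        linarith
    _ ≤ 1 * (f ^ 2 * G / (2 * l ^ (2 * m - 1) * Real.pi * ((k : ℝ) + 2))) * N ^ x
          / (n : ℝ) ^ (2 * m - 1) := by gcongr
    _ = _ := by
        rw [hK]; field_simp
end

section
/- Fix integers k, m ≥ 1, let λ = 1/2, and fix ε > 0. There exists n₀ such that for all n ≥ n₀ the following holds: if Σ = (a_1, …, a_n) is a sequence in ℤ^k with every entry in [0, M]^k such that e^m_Σ(A₁) ≠ e^m_Σ(A₂) for all distinct A₁, A₂ ∈ F_{1/2,n} with |A₁|, |A₂| ≥ m, then M^{2m} ≥ (1 − ε) · (2^{2m} · ((m−1)!)² · Γ(k/2 + 1)^{2/k} / ((2^{2m+1}·(1/2)^{2m−1} + 2^{2m+1}·(1/2)^{2m} + 1) · π · (k+2))) · |F_{1/2,n}|^{2/k} / n^{2m−1}. -/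
theorem poincare {α : Type*} [DecidableEq α] (s : Finset α) : ∀ f : Finset α → ℝ,
    2 ^ s.card * ∑ A ∈ s.powerset, f A ^ 2 - (∑ A ∈ s.powerset, f A) ^ 2 ≤
      2 ^ s.card / 2 * ∑ i ∈ s, ∑ A ∈ (s.erase i).powerset, (f (insert i A) - f A) ^ 2 := by
  induction s using Finset.induction_on with
  | empty => intro f; simp
  | insert a s ha ih =>
    intro f
    have h0 := ih f
    have h1 := ih (fun A => f (insert a A))
    have hcs : (∑ A ∈ s.powerset, (f (insert a A) - f A)) ^ 2 ≤
        2 ^ s.card * ∑ A ∈ s.powerset, (f (insert a A) - f A) ^ 2 := by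
      have := sq_sum_le_card_mul_sum_sq (s := s.powerset) (f := fun A => f (insert a A) - f A)
      simpa using this
    rw [Finset.sum_sub_distrib] at hcs
    rw [Finset.sum_powerset_insert ha, Finset.sum_powerset_insert ha, Finset.card_insert_of_notMem ha,
      Finset.sum_insert ha, Finset.erase_insert ha]
    have hs : ∑ i ∈ s, ∑ A ∈ ((insert a s).erase i).powerset, (f (insert i A) - f A) ^ 2 =
        ∑ i ∈ s, ∑ A ∈ (s.erase i).powerset, (f (insert i A) - f A) ^ 2 +
        ∑ i ∈ s, ∑ A ∈ (s.erase i).powerset, (f (insert a (insert i A)) - f (insert a A)) ^ 2 := by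
      rw [← Finset.sum_add_distrib]
      refine Finset.sum_congr rfl fun i hi => ?_
      have hia : a ≠ i := by rintro rfl; exact ha hi
      rw [Finset.erase_insert_of_ne hia, Finset.sum_powerset_insert (by simp [ha])]
      congr 1
      refine Finset.sum_congr rfl fun A _ => ?_
      rw [Finset.insert_comm]
    rw [hs, pow_succ]
    nlinarith

theorem sum_card_pow {α : Type*} [DecidableEq α] (s : Finset α) (n p : ℕ) (hn : s.card + 1 = n)
    (hp : p ^ 2 ≤ n) :
    ∑ A ∈ s.powerset, (A.card : ℝ) ^ p ≤ ((n : ℝ) / 2) ^ p * 2 ^ s.card * Real.exp (1 / 2) := by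
  have hn0 : (0 : ℝ) < n := by exact_mod_cast (by omega : 0 < n)
  set x : ℝ := Real.exp (2 * p / n) with hx
  have hx1 : 1 ≤ x := Real.one_le_exp (by positivity)
  have h1 : ∀ A ∈ s.powerset, (A.card : ℝ) ^ p ≤ ((n : ℝ) / 2) ^ p * (Real.exp (-p) * x ^ A.card) := by
    intro A _
    have : (2 * A.card / n : ℝ) ≤ Real.exp (2 * A.card / n - 1) := by
      have := Real.add_one_le_exp (2 * A.card / n - 1 : ℝ)
      linarith
    have h2 : (2 * A.card / n : ℝ) ^ p ≤ Real.exp (-p) * x ^ A.card := by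
      refine (pow_le_pow_left₀ (by positivity) this p).trans (le_of_eq ?_)
      rw [hx, ← Real.exp_nat_mul, ← Real.exp_nat_mul, ← Real.exp_add]
      congr 1
      field_simp
      ring
    calc (A.card : ℝ) ^ p = ((n : ℝ) / 2) ^ p * (2 * A.card / n : ℝ) ^ p := by
          rw [← mul_pow]; congr 1; field_simp
      _ ≤ _ := by gcongr
  refine (Finset.sum_le_sum h1).trans ?_
  rw [← Finset.mul_sum, ← Finset.mul_sum, mul_assoc]
  refine mul_le_mul_of_nonneg_left ?_ (by positivity)
  have h3 : ∑ A ∈ s.powerset, x ^ A.card = (1 + x) ^ s.card := by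
    have := Finset.sum_pow_mul_eq_add_pow x 1 s
    simpa [add_comm] using this
  rw [h3]
  have h4 : Real.exp (-p) * (1 + x) ^ n = 2 ^ n * Real.cosh (p / n) ^ n := by
    have : Real.exp (-p) = Real.exp (-(p / n)) ^ n := by
      rw [← Real.exp_nat_mul]; congr 1; field_simp
    rw [this, ← mul_pow, ← mul_pow]
    congr 1
    rw [Real.cosh_eq, hx, mul_add, ← Real.exp_add]
    ring_nf
  have h5 : Real.cosh (p / n) ^ n ≤ Real.exp (1 / 2) := by
    refine (pow_le_pow_left₀ (Real.cosh_pos _).le (Real.cosh_le_exp_half_sq _) n).trans ?_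
    rw [← Real.exp_nat_mul]
    apply Real.exp_le_exp.mpr
    have : (p : ℝ) ^ 2 ≤ n := by exact_mod_cast hp
    rw [div_pow]
    field_simp
    exact this
  have h6 : 2 * (Real.exp (-p) * (1 + x) ^ s.card) ≤ Real.exp (-p) * (1 + x) ^ n := by
    rw [← hn, pow_succ]
    have : 0 ≤ Real.exp (-p) * (1 + x) ^ s.card := by positivity
    nlinarith
  rw [h4] at h6
  have h7 : (2 : ℝ) ^ n = 2 * 2 ^ s.card := by rw [← hn, pow_succ]; ring
  rw [h7] at h6
  have : (2 : ℝ) ^ s.card * Real.cosh (p / n) ^ n ≤ 2 ^ s.card * Real.exp (1 / 2) := by gcongr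
  linarith

open MeasureTheory in
theorem ball_int (k : ℕ) (hk : 1 ≤ k) (R : ℝ) (hR : 0 ≤ R) (μ : EuclideanSpace ℝ (Fin k)) :
    Integrable (fun y : EuclideanSpace ℝ (Fin k) => max (R ^ 2 - ‖y - μ‖ ^ 2) 0) ∧
    ∫ y : EuclideanSpace ℝ (Fin k), max (R ^ 2 - ‖y - μ‖ ^ 2) 0 =
      volume.real (Metric.ball (0 : EuclideanSpace ℝ (Fin k)) 1) * R ^ (k + 2) * (2 / (k + 2)) := by
  have : Nonempty (Fin k) := ⟨⟨0, hk⟩⟩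
  constructor
  · apply Continuous.integrable_of_hasCompactSupport (by fun_prop)
    apply HasCompactSupport.of_support_subset_isCompact (isCompact_closedBall μ R)
    intro y hy
    rw [Function.mem_support] at hy
    rw [Metric.mem_closedBall, dist_eq_norm]
    by_contra hc
    push Not at hc
    apply hy
    apply max_eq_right
    nlinarith
  · rw [integral_sub_right_eq_self (fun y : EuclideanSpace ℝ (Fin k) => max (R ^ 2 - ‖y‖ ^ 2) 0) μ]
    rw [integral_fun_norm_addHaar volume (fun t : ℝ => max (R ^ 2 - t ^ 2) 0)]
    have h1 : ∫ y in Set.Ioi (0:ℝ), y ^ (k - 1) • max (R ^ 2 - y ^ 2) 0 =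
        ∫ y in (0:ℝ)..R, (R ^ 2 * y ^ (k - 1) - y ^ (k + 1)) := by
      rw [intervalIntegral.integral_of_le hR]
      rw [setIntegral_eq_of_subset_of_forall_sdiff_eq_zero measurableSet_Ioi
        (Set.Ioc_subset_Ioi_self : Set.Ioc 0 R ⊆ Set.Ioi 0)]
      · refine setIntegral_congr_fun measurableSet_Ioc fun y hy => ?_
        have : y ^ 2 ≤ R ^ 2 := pow_le_pow_left₀ hy.1.le hy.2 2
        simp only [smul_eq_mul]
        rw [max_eq_left (by linarith)]
        obtain ⟨k, rfl⟩ : ∃ l, k = l + 1 := ⟨k - 1, by omega⟩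
        simp only [Nat.add_sub_cancel]
        ring
      · intro y hy
        have h0 : 0 < y := hy.1
        have : R < y := by
          by_contra hc
          exact hy.2 ⟨h0, not_lt.mp hc⟩
        rw [max_eq_right (by nlinarith)]
        simp
    rw [finrank_euclideanSpace_fin, h1, intervalIntegral.integral_sub ((by fun_prop : Continuous fun y : ℝ => R ^ 2 * y ^ (k - 1)).intervalIntegrable _ _)
      ((by fun_prop : Continuous fun y : ℝ => y ^ (k + 1)).intervalIntegrable _ _),
      intervalIntegral.integral_const_mul, integral_pow, integral_pow]
    obtain ⟨k, rfl⟩ : ∃ l, k = l + 1 := ⟨k - 1, by omega⟩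
    simp
    field_simp
    ring

open MeasureTheory in
theorem cube_lemma (k : ℕ) (hk : 1 ≤ k) (R : ℝ) (hR : 0 ≤ R) (μ : EuclideanSpace ℝ (Fin k))
    (P : Finset (Fin k → ℤ)) :
    ∑ x ∈ P, (R ^ 2 - 3 * k - 3 / 2 * ∑ j, ((x j : ℝ) - μ j) ^ 2) ≤
      volume.real (Metric.ball (0 : EuclideanSpace ℝ (Fin k)) 1) * R ^ (k + 2) * (2 / (k + 2)) := by
  obtain ⟨hi, he⟩ := ball_int k hk R hR μ
  set Q : (Fin k → ℤ) → Set (EuclideanSpace ℝ (Fin k)) := fun x =>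
    WithLp.ofLp ⁻¹' (Set.univ.pi fun i => Set.Ico (x i : ℝ) (x i + 1)) with hQ
  have hm0 : ∀ x : Fin k → ℤ, MeasurableSet (Set.univ.pi fun i => Set.Ico (x i : ℝ) (x i + 1)) :=
    fun x => MeasurableSet.univ_pi fun i => measurableSet_Ico
  have hm : ∀ x, MeasurableSet (Q x) := fun x =>
    (PiLp.volume_preserving_ofLp (Fin k)).measurable (hm0 x)
  have hv : ∀ x, volume (Q x) = 1 := by
    intro x
    rw [hQ, (PiLp.volume_preserving_ofLp (Fin k)).measure_preimage (hm0 x).nullMeasurableSet,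
      Real.volume_pi_Ico]
    simp
  have hmem : ∀ x y, y ∈ Q x → ∀ j, (x j : ℝ) ≤ y j ∧ y j < x j + 1 := by
    intro x y hy j
    exact hy j trivial
  have hd : (↑P : Set (Fin k → ℤ)).Pairwise (Function.onFun Disjoint Q) := by
    intro x _ x' _ hne
    rw [Function.onFun, Set.disjoint_left]
    intro y hy hy'
    apply hne
    funext j
    have h1 := hmem x y hy j
    have h2 := hmem x' y hy' j
    rw [← Int.floor_eq_iff] at h1 h2
    rw [← h1, ← h2]
  rw [← he]
  refine le_trans ?_ (setIntegral_le_integral (s := ⋃ x ∈ P, Q x) hi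
    (Filter.Eventually.of_forall fun y => le_max_right _ _))
  rw [integral_biUnion_finset P (fun x _ => hm x) hd (fun x _ => hi.integrableOn)]
  refine Finset.sum_le_sum fun x _ => ?_
  have hc : ∫ y in Q x, (R ^ 2 - 3 * k - 3 / 2 * ∑ j, ((x j : ℝ) - μ j) ^ 2) =
      (R ^ 2 - 3 * k - 3 / 2 * ∑ j, ((x j : ℝ) - μ j) ^ 2) := by
    rw [setIntegral_const, Measure.real, hv]; simp
  rw [← hc]
  refine setIntegral_mono_on (integrableOn_const (by rw [hv]; simp)) hi.integrableOn (hm x) ?_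
  intro y hy
  refine le_trans ?_ (le_max_left _ _)
  rw [EuclideanSpace.norm_sq_eq]
  have : ∑ j, ‖(y - μ) j‖ ^ 2 ≤ ∑ j : Fin k, (3 / 2 * ((x j : ℝ) - μ j) ^ 2 + 3) := by
    refine Finset.sum_le_sum fun j _ => ?_
    obtain ⟨h1, h2⟩ := hmem x y hy j
    rw [Real.norm_eq_abs, sq_abs, PiLp.sub_apply]
    nlinarith [sq_nonneg ((x j - μ j : ℝ) - 2 * (y j - x j))]
  rw [Finset.sum_add_distrib, ← Finset.mul_sum] at this
  simp only [Finset.sum_const, Finset.card_univ, Fintype.card_fin, nsmul_eq_mul] at this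
  linarith

theorem cube_lemma2 (k : ℕ) (hk : 1 ≤ k) (μ : Fin k → ℝ) (P : Finset (Fin k → ℤ)) :
    P.card * ((P.card : ℝ) ^ ((2 : ℝ) / k) * (Real.Gamma ((k : ℝ) / 2 + 1) ^ ((2 : ℝ) / k) / Real.pi)
       * (k / (k + 2)) - 3 * k) ≤ 3 / 2 * ∑ x ∈ P, ∑ j, ((x j : ℝ) - μ j) ^ 2 := by
  have hk0 : (0 : ℝ) < k := by exact_mod_cast hk
  have : Nonempty (Fin k) := ⟨⟨0, hk⟩⟩
  have hG : 0 < Real.Gamma ((k : ℝ) / 2 + 1) := Real.Gamma_pos_of_pos (by positivity)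
  set N : ℝ := (P.card : ℝ) with hN
  have hN0 : 0 ≤ N := by positivity
  set V : ℝ := MeasureTheory.volume.real (Metric.ball (0 : EuclideanSpace ℝ (Fin k)) 1) with hV
  have hV' : V = √Real.pi ^ k / Real.Gamma ((k : ℝ) / 2 + 1) := by
    rw [hV, MeasureTheory.Measure.real, EuclideanSpace.volume_ball]
    simp
    positivity
  set R : ℝ := (N * Real.Gamma ((k : ℝ) / 2 + 1)) ^ ((1 : ℝ) / k) / √Real.pi with hR
  have hR0 : 0 ≤ R := by positivity
  have hpi : 0 < √Real.pi := Real.sqrt_pos.mpr Real.pi_pos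
  have hRk : V * R ^ k = N := by
    rw [hR, div_pow, hV', ← Real.rpow_natCast (_ ^ _), ← Real.rpow_mul (by positivity)]
    rw [one_div_mul_cancel hk0.ne', Real.rpow_one]
    field_simp
  have hR2 : R ^ 2 = N ^ ((2 : ℝ) / k) * (Real.Gamma ((k : ℝ) / 2 + 1) ^ ((2 : ℝ) / k) / Real.pi) := by
    rw [hR, div_pow, Real.sq_sqrt Real.pi_pos.le, ← Real.rpow_natCast (_ ^ _),
      ← Real.rpow_mul (by positivity), Real.mul_rpow hN0 hG.le]
    push_cast
    rw [one_div_mul_eq_div]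
    ring
  have h := cube_lemma k hk R hR0 (WithLp.toLp 2 μ) P
  rw [← hV, pow_add, ← mul_assoc, hRk] at h
  rw [Finset.sum_sub_distrib, ← Finset.mul_sum, Finset.sum_const, nsmul_eq_mul, ← hN] at h
  simp only at h
  rw [← hR2]
  have : N * (R ^ 2 * (k / (k + 2)) - 3 * k) = N * (R ^ 2 - 3 * k) - N * R ^ 2 * (2 / (k + 2)) := by
    field_simp
    ring
  linarith

theorem eval_diff (n k r : ℕ) (a : Fin n → Fin k → ℤ) (i : Fin n) (A : Finset (Fin n)) (hi : i ∉ A)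
    (j : Fin k) : mthEvalVec n k (r + 1) a (insert i A) j - mthEvalVec n k (r + 1) a A j =
      a i j * mthEvalVec n k r a A j := by
  unfold mthEvalVec
  rw [Finset.powersetCard_succ_insert hi, Finset.sum_union, Finset.sum_image, Finset.mul_sum]
  · rw [add_sub_cancel_left]
    refine Finset.sum_congr rfl fun S hS => ?_
    rw [Finset.prod_insert]
    intro h
    exact hi ((Finset.mem_powersetCard.mp hS).1 h)
  · intro S hS T hT h
    have h1 : i ∉ S := fun h => hi ((Finset.mem_powersetCard.mp hS).1 h)
    have h2 : i ∉ T := fun h => hi ((Finset.mem_powersetCard.mp hT).1 h)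
    rw [← Finset.erase_insert h1, ← Finset.erase_insert h2, h]
  · rw [Finset.disjoint_left]
    intro S hS hS'
    obtain ⟨T, _, rfl⟩ := Finset.mem_image.mp hS'
    exact hi ((Finset.mem_powersetCard.mp hS).1 (Finset.mem_insert_self _ _))

theorem eval_bound (n k r : ℕ) (a : Fin n → Fin k → ℤ) (M : ℤ)
    (ha : ∀ i j, 0 ≤ a i j ∧ a i j ≤ M) (A : Finset (Fin n)) (j : Fin k) :
    0 ≤ mthEvalVec n k r a A j ∧ mthEvalVec n k r a A j ≤ A.card.choose r * M ^ r := by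
  unfold mthEvalVec
  constructor
  · exact Finset.sum_nonneg fun S _ => Finset.prod_nonneg fun i _ => (ha i j).1
  · rw [← Finset.card_powersetCard, ← nsmul_eq_mul]
    refine Finset.sum_le_card_nsmul _ _ _ fun S hS => ?_
    rw [← (Finset.mem_powersetCard.mp hS).2]
    rw [← Finset.prod_const]
    exact Finset.prod_le_prod (fun i _ => (ha i j).1) (fun i _ => (ha i j).2)

theorem variance_bound (n k r : ℕ) (hn : 1 ≤ n) (hr : (2 * r) ^ 2 ≤ n) (a : Fin n → Fin k → ℤ) (M : ℤ)
    (ha : ∀ i j, 0 ≤ a i j ∧ a i j ≤ M) (j : Fin k) :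
    ∃ μ : ℝ, ∑ A : Finset (Fin n), ((mthEvalVec n k (r + 1) a A j : ℝ) - μ) ^ 2 ≤
      2 ^ n * Real.exp (1 / 2) *
        ((M : ℝ) ^ (2 * (r + 1)) * (n : ℝ) ^ (2 * r + 1) / (4 ^ (r + 1) * (r.factorial : ℝ) ^ 2)) := by
  set f : Finset (Fin n) → ℝ := fun A => (mthEvalVec n k (r + 1) a A j : ℝ) with hf
  have hp := poincare (Finset.univ : Finset (Fin n)) f
  simp only [Finset.powerset_univ, Finset.card_univ, Fintype.card_fin] at hp
  have hM : (0 : ℝ) ≤ M := by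
    have := ha ⟨0, hn⟩ j
    exact_mod_cast this.1.trans this.2
  have hi : ∀ i ∈ (Finset.univ : Finset (Fin n)),
      ∑ A ∈ (Finset.univ.erase i).powerset, (f (insert i A) - f A) ^ 2 ≤
      ((M : ℝ) ^ (r + 1) / r.factorial) ^ 2 * (((n : ℝ) / 2) ^ (2 * r) * 2 ^ (n - 1) * Real.exp (1 / 2)) := by
    intro i _
    have hc : ((Finset.univ : Finset (Fin n)).erase i).card = n - 1 := by simp
    have hs := sum_card_pow ((Finset.univ : Finset (Fin n)).erase i) n (2 * r) (by rw [hc]; omega) hr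
    rw [hc] at hs
    refine le_trans ?_ (mul_le_mul_of_nonneg_left hs (by positivity))
    rw [Finset.mul_sum]
    refine Finset.sum_le_sum fun A hA => ?_
    have hiA : i ∉ A := fun h => by simpa using (Finset.mem_powerset.mp hA) h
    have hd : f (insert i A) - f A = a i j * mthEvalVec n k r a A j := by
      simp only [hf]; exact_mod_cast eval_diff n k r a i A hiA j
    rw [hd]
    obtain ⟨h1, h2⟩ := eval_bound n k r a M ha A j
    have h1' : (0 : ℝ) ≤ mthEvalVec n k r a A j := by exact_mod_cast h1
    have h2' : (mthEvalVec n k r a A j : ℝ) ≤ A.card.choose r * M ^ r := by exact_mod_cast h2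
    have h3 : (0 : ℝ) ≤ a i j := by exact_mod_cast (ha i j).1
    have h4 : (a i j : ℝ) ≤ M := by exact_mod_cast (ha i j).2
    have h5 : (A.card.choose r : ℝ) ≤ (A.card : ℝ) ^ r / r.factorial := Nat.choose_le_pow_div r A.card
    rw [pow_mul' _ 2 r, ← mul_pow]
    refine pow_le_pow_left₀ (by positivity) ?_ 2
    calc (a i j : ℝ) * mthEvalVec n k r a A j ≤ M * ((A.card : ℝ) ^ r / r.factorial * M ^ r) := by
          gcongr
          exact h2'.trans (by gcongr)
      _ = _ := by ring
  have hsum := Finset.sum_le_sum hi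
  rw [Finset.sum_const, Finset.card_univ, Fintype.card_fin, nsmul_eq_mul] at hsum
  refine ⟨(∑ A, f A) / 2 ^ n, ?_⟩
  have hexp : ∑ A, (f A - (∑ A, f A) / 2 ^ n) ^ 2 = ∑ A, f A ^ 2 - (∑ A, f A) ^ 2 / 2 ^ n := by
    simp only [sub_sq, Finset.sum_add_distrib, Finset.sum_sub_distrib, ← Finset.sum_mul, ← Finset.mul_sum,
      Finset.sum_const, Finset.card_univ, Fintype.card_finset, Fintype.card_fin, nsmul_eq_mul]
    push_cast
    field_simp
    ring
  rw [hexp]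
  have h2n : (0 : ℝ) < 2 ^ n := by positivity
  have : ∑ A, f A ^ 2 - (∑ A, f A) ^ 2 / 2 ^ n ≤ 1 / 2 * (n * (((M : ℝ) ^ (r + 1) / r.factorial) ^ 2 * (((n : ℝ) / 2) ^ (2 * r) * 2 ^ (n - 1) * Real.exp (1 / 2)))) := by
    rw [← mul_le_mul_iff_right₀ h2n, mul_sub, mul_div_cancel₀ _ h2n.ne']
    refine hp.trans ?_
    rw [div_mul_eq_mul_div, mul_div_assoc]
    refine mul_le_mul_of_nonneg_left ?_ h2n.le
    linarith
  refine this.trans (le_of_eq ?_)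
  obtain ⟨n, rfl⟩ : ∃ l, n = l + 1 := ⟨n - 1, by omega⟩
  have h4 : (4 : ℝ) ^ (r + 1) = 4 * 2 ^ (2 * r) := by rw [pow_mul, pow_succ]; norm_num; ring
  rw [h4, Nat.add_sub_cancel, div_pow, div_pow]
  field_simp
  ring

theorem fam_card (n : ℕ) : (2 : ℝ) ^ n ≤ 2 * (Fam n (1 / 2)).card := by
  have h : (Finset.univ : Finset (Finset (Fin n))) ⊆ Fam n (1 / 2) ∪ (Fam n (1 / 2)).image compl := by
    intro A _
    rw [Finset.mem_union]
    by_cases hA : (A.card : ℝ) ≤ 1 / 2 * n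
    · left; simpa [Fam] using hA
    · right
      refine Finset.mem_image.mpr ⟨Aᶜ, ?_, compl_compl A⟩
      simp only [Fam, Finset.mem_filter, Finset.mem_univ, true_and]
      have := Finset.card_add_card_compl A
      rw [Fintype.card_fin] at this
      have : (A.card : ℝ) + (Aᶜ.card : ℝ) = n := by exact_mod_cast this
      linarith
  have h2 := (Finset.card_le_card h).trans (Finset.card_union_le _ _)
  have h3 := Finset.card_image_le (s := Fam n (1 / 2)) (f := compl)
  simp only [Finset.card_univ, Fintype.card_finset, Fintype.card_fin] at h2
  have : 2 ^ n ≤ 2 * (Fam n (1 / 2)).card := by omega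
  exact_mod_cast this

theorem small_card (n m : ℕ) (hn : 1 ≤ n) :
    (Finset.univ.filter (fun A : Finset (Fin n) => A.card < m)).card ≤ m * n ^ m := by
  have h : Finset.univ.filter (fun A : Finset (Fin n) => A.card < m) ⊆
      (Finset.range m).biUnion (fun i => Finset.powersetCard i Finset.univ) := by
    intro A hA
    simp at hA ⊢
    exact hA
  refine (Finset.card_le_card h).trans (Finset.card_biUnion_le.trans ?_)
  refine (Finset.sum_le_card_nsmul _ _ (n ^ m) fun i hi => ?_).trans (by simp)
  rw [Finset.card_powersetCard, Finset.card_univ, Fintype.card_fin]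
  exact (Nat.choose_le_pow n i).trans (Nat.pow_le_pow_right hn (Finset.mem_range.mp hi).le)

set_option maxHeartbeats 2000000 in
theorem stmt10 (k m : ℕ) (hk : 1 ≤ k) (hm : 1 ≤ m) (ε : ℝ) (hε : 0 < ε) :
    ∃ n₀ : ℕ, ∀ n : ℕ, n₀ ≤ n → ∀ M : ℤ, ∀ a : Fin n → Fin k → ℤ,
      (∀ i j, 0 ≤ a i j ∧ a i j ≤ M) →
      (∀ A₁ A₂ : Finset (Fin n), A₁ ∈ Fam n (1 / 2) → A₂ ∈ Fam n (1 / 2) → A₁ ≠ A₂ →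
        m ≤ A₁.card → m ≤ A₂.card → mthEvalVec n k m a A₁ ≠ mthEvalVec n k m a A₂) →
      (M : ℝ) ^ (2 * m) ≥ (1 - ε) *
        ((2 : ℝ) ^ (2 * m) * (((m - 1).factorial : ℝ)) ^ 2 *
            Real.Gamma ((k : ℝ) / 2 + 1) ^ ((2 : ℝ) / k) /
          ((2 ^ (2 * m + 1) * (1 / 2 : ℝ) ^ (2 * m - 1) +
              2 ^ (2 * m + 1) * (1 / 2 : ℝ) ^ (2 * m) + 1) * Real.pi * ((k : ℝ) + 2))) *
        (((Fam n (1 / 2)).card : ℝ)) ^ ((2 : ℝ) / k) / (n : ℝ) ^ (2 * m - 1) := by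
  obtain ⟨r, rfl⟩ : ∃ r, m = r + 1 := ⟨m - 1, by omega⟩
  have hk0 : (0 : ℝ) < k := by exact_mod_cast hk
  have hG : 0 < Real.Gamma ((k : ℝ) / 2 + 1) := Real.Gamma_pos_of_pos (by positivity)
  set G : ℝ := Real.Gamma ((k : ℝ) / 2 + 1) ^ ((2 : ℝ) / k) / Real.pi with hGdef
  have hG0 : 0 < G := by positivity
  -- asymptotic facts
  have hE1 : ∀ᶠ n : ℕ in Filter.atTop, ((r + 1 : ℕ) : ℝ) * ((n : ℝ) ^ (r + 1) / 2 ^ n) ≤ 1 / 40 := by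
    have h := (tendsto_pow_const_div_const_pow_of_one_lt (r + 1) (one_lt_two : (1 : ℝ) < 2)).const_mul
      ((r + 1 : ℕ) : ℝ)
    rw [mul_zero] at h
    exact h.eventually_le_const (by norm_num)
  have hE2 : ∀ᶠ n : ℕ in Filter.atTop,
      24 * ((k : ℝ) + 2) / G ≤ ((2 : ℝ) ^ n / 2) ^ ((2 : ℝ) / k) := by
    have h1 : Filter.Tendsto (fun n : ℕ => (2 : ℝ) ^ n / 2) Filter.atTop Filter.atTop :=
      (tendsto_pow_atTop_atTop_of_one_lt one_lt_two).atTop_div_const (by norm_num)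
    exact ((tendsto_rpow_atTop (by positivity : (0 : ℝ) < 2 / k)).comp h1).eventually_ge_atTop _
  obtain ⟨n₀, hn₀⟩ := Filter.eventually_atTop.mp
    ((hE1.and hE2).and (Filter.eventually_ge_atTop ((2 * r) ^ 2 + 1)))
  refine ⟨n₀, fun n hn M a ha hinj => ?_⟩
  obtain ⟨⟨hS, hL⟩, hnr⟩ := hn₀ n hn
  have hn1 : 1 ≤ n := by omega
  have hn0 : (0 : ℝ) < n := by exact_mod_cast hn1
  set F : ℝ := ((Fam n (1 / 2)).card : ℝ) with hF
  have hF2 : (2 : ℝ) ^ n ≤ 2 * F := fam_card n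
  have h2n : (0 : ℝ) < 2 ^ n := by positivity
  have hF0 : 0 < F := by linarith
  have hM : (0 : ℝ) ≤ M := by
    have := ha ⟨0, hn1⟩ ⟨0, hk⟩
    exact_mod_cast this.1.trans this.2
  set K : ℝ := (M : ℝ) ^ (2 * (r + 1)) * (n : ℝ) ^ (2 * r + 1) / (4 ^ (r + 1) * (r.factorial : ℝ) ^ 2) with hK
  have hK0 : 0 ≤ K := by positivity
  -- the family
  set Fm := (Fam n (1 / 2)).filter (fun A => r + 1 ≤ A.card) with hFm
  set P := Fm.image (mthEvalVec n k (r + 1) a) with hP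
  have hinj' : Set.InjOn (mthEvalVec n k (r + 1) a) (↑Fm : Set (Finset (Fin n))) := by
    intro A hA B hB h
    by_contra hne
    have hA' := Finset.mem_filter.mp (Finset.mem_coe.mp hA)
    have hB' := Finset.mem_filter.mp (Finset.mem_coe.mp hB)
    exact hinj A B hA'.1 hB'.1 hne hA'.2 hB'.2 h
  have hPc : P.card = Fm.card := Finset.card_image_of_injOn hinj'
  set N : ℝ := (P.card : ℝ) with hN
  have hNle : N ≤ F := by
    rw [hN, hPc, hF]; exact_mod_cast Finset.card_filter_le _ _
  have hNge : 95 / 100 * F ≤ N := by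
    have h1 := Finset.card_filter_add_card_filter_not (s := Fam n (1 / 2)) (fun A => r + 1 ≤ A.card)
    have h2 : ((Fam n (1 / 2)).filter (fun A => ¬ r + 1 ≤ A.card)).card ≤ (r + 1) * n ^ (r + 1) := by
      refine le_trans (Finset.card_le_card ?_) (small_card n (r + 1) hn1)
      intro A hA
      simp only [Finset.mem_filter, Finset.mem_univ, true_and, not_le] at hA ⊢
      exact hA.2
    have h3 : F ≤ N + ((r + 1 : ℕ) : ℝ) * (n : ℝ) ^ (r + 1) := by
      rw [hF, hN, hPc]
      have : (Fam n (1 / 2)).card ≤ Fm.card + (r + 1) * n ^ (r + 1) := by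
        rw [hFm]; omega
      exact_mod_cast this
    rw [← mul_div_assoc, div_le_iff₀ h2n] at hS
    linarith
  choose μ hμ using fun j => variance_bound n k r hn1 (by omega) a M ha j
  have hlow := cube_lemma2 k hk μ P
  rw [← hN, ← hGdef] at hlow
  have hup : ∑ x ∈ P, ∑ j, ((x j : ℝ) - μ j) ^ 2 ≤ k * (2 ^ n * Real.exp (1 / 2) * K) := by
    rw [hP, Finset.sum_image hinj', Finset.sum_comm]
    have : ∀ j ∈ (Finset.univ : Finset (Fin k)),
        ∑ A ∈ Fm, ((mthEvalVec n k (r + 1) a A j : ℝ) - μ j) ^ 2 ≤ 2 ^ n * Real.exp (1 / 2) * K := by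
      intro j _
      refine le_trans ?_ (hμ j)
      exact Finset.sum_le_sum_of_subset_of_nonneg (Finset.subset_univ _) fun _ _ _ => sq_nonneg _
    refine (Finset.sum_le_sum this).trans (by simp)
  have hexp : Real.exp (1 / 2) ≤ 5 / 3 := by
    have h1 : Real.exp (1 / 2) ^ 2 = Real.exp 1 := by rw [← Real.exp_nat_mul]; norm_num
    have := Real.exp_one_lt_d9
    have h0 := Real.exp_pos (1 / 2)
    nlinarith
  set X : ℝ := F ^ ((2 : ℝ) / k) * G / (k + 2) with hX
  have hX24 : 24 ≤ X := by
    rw [hX, le_div_iff₀ (by positivity), ← div_le_iff₀ hG0]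
    exact hL.trans (Real.rpow_le_rpow (by positivity) (by linarith) (by positivity))
  have hNpow : (95 / 100 : ℝ) ^ 2 * F ^ ((2 : ℝ) / k) ≤ N ^ ((2 : ℝ) / k) := by
    have h1 : (95 / 100 : ℝ) ^ 2 ≤ (95 / 100 : ℝ) ^ ((2 : ℝ) / k) := by
      rw [← Real.rpow_natCast]
      refine Real.rpow_le_rpow_of_exponent_ge (by norm_num) (by norm_num) ?_
      push_cast
      exact div_le_self (by norm_num) (by exact_mod_cast hk)
    calc (95 / 100 : ℝ) ^ 2 * F ^ ((2 : ℝ) / k) ≤ (95 / 100 : ℝ) ^ ((2 : ℝ) / k) * F ^ ((2 : ℝ) / k) := by gcongr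
      _ = (95 / 100 * F) ^ ((2 : ℝ) / k) := (Real.mul_rpow (by norm_num) hF0.le).symm
      _ ≤ _ := Real.rpow_le_rpow (by positivity) hNge (by positivity)
  have hkey : X ≤ 7 * K := by
    have e1 : N * k * ((95 / 100 : ℝ) ^ 2 * X - 3) ≤ N * (N ^ ((2 : ℝ) / k) * G * (k / (k + 2)) - 3 * k) := by
      have : (95 / 100 : ℝ) ^ 2 * X * k ≤ N ^ ((2 : ℝ) / k) * G * (k / (k + 2)) := by
        calc (95 / 100 : ℝ) ^ 2 * X * k = ((95 / 100 : ℝ) ^ 2 * F ^ ((2 : ℝ) / k)) * G * (k / (k + 2)) := by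
              rw [hX]; ring
          _ ≤ _ := by gcongr
      have hN0 : 0 ≤ N := by positivity
      nlinarith
    have e2 : (95 / 100 * F) * k * ((95 / 100 : ℝ) ^ 2 * X - 3) ≤ N * k * ((95 / 100 : ℝ) ^ 2 * X - 3) := by
      have : 0 ≤ (95 / 100 : ℝ) ^ 2 * X - 3 := by linarith
      gcongr
    have e3 : k * (2 ^ n * Real.exp (1 / 2) * K) ≤ k * ((2 * F) * (5 / 3) * K) := by gcongr
    have e4 : (F * k) * (95 / 100 * ((95 / 100 : ℝ) ^ 2 * X - 3)) ≤ (F * k) * (5 * K) := by linarith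
    have e5 := le_of_mul_le_mul_left e4 (by positivity)
    linarith
  -- conclusion
  have hconst : ((2 : ℝ) ^ (2 * (r + 1) + 1) * (1 / 2 : ℝ) ^ (2 * (r + 1) - 1) +
              2 ^ (2 * (r + 1) + 1) * (1 / 2 : ℝ) ^ (2 * (r + 1)) + 1) = 7 := by
    rw [show 2 * (r + 1) - 1 = 2 * r + 1 by omega]
    have h : (2 : ℝ) ^ (2 * r) * (1 / 2 : ℝ) ^ (2 * r) = 1 := by rw [← mul_pow]; norm_num
    ring_nf at h ⊢
    linarith
  rw [hconst, show 2 * (r + 1) - 1 = 2 * r + 1 by omega, Nat.add_sub_cancel]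
  have h4 : (2 : ℝ) ^ (2 * (r + 1)) = 4 ^ (r + 1) := by rw [pow_mul]; norm_num
  have hC : (0 : ℝ) < 4 ^ (r + 1) * (r.factorial : ℝ) ^ 2 / (7 * (n : ℝ) ^ (2 * r + 1)) := by positivity
  have hrw : (1 - ε) * ((2 : ℝ) ^ (2 * (r + 1)) * (r.factorial : ℝ) ^ 2 *
            Real.Gamma ((k : ℝ) / 2 + 1) ^ ((2 : ℝ) / k) / (7 * Real.pi * ((k : ℝ) + 2))) *
        F ^ ((2 : ℝ) / k) / (n : ℝ) ^ (2 * r + 1) =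
      (1 - ε) * X * (4 ^ (r + 1) * (r.factorial : ℝ) ^ 2 / (7 * (n : ℝ) ^ (2 * r + 1))) := by
    rw [h4, hX, hGdef]
    field_simp
  have hMK : (M : ℝ) ^ (2 * (r + 1)) =
      7 * K * (4 ^ (r + 1) * (r.factorial : ℝ) ^ 2 / (7 * (n : ℝ) ^ (2 * r + 1))) := by
    rw [hK]
    field_simp
  rw [hrw, hMK, ge_iff_le]
  refine mul_le_mul_of_nonneg_right ?_ hC.le
  nlinarith
end

section
/- Let ε > 0 be a real number and let m ≥ 2 be an integer. There exists n₀ such that for every n ≥ n₀ the sequence of real numbers Σ = (a_1, …, a_n) with a_i = (2+ε)^n − 2^{i−1} for i = 1, …, n satisfies |e^m_Σ(A₁) − e^m_Σ(A₂)| ≥ 1 for all distinct subsets A₁, A₂ ⊆ {1, …, n} with |A₁|, |A₂| ≥ m. -/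
/-- The `m`-th evaluation of the real sequence `a` on the subset `A`:
the sum over all `m`-element subsets of `A` of the product of the entries.
It is `0` when `|A| < m`. -/
noncomputable def mthEvalR (n m : ℕ) (a : Fin n → ℝ) (A : Finset (Fin n)) : ℝ :=
  ∑ S ∈ A.powersetCard m, ∏ i ∈ S, a i

lemma ev_zero (n : ℕ) (x : Fin n → ℝ) (A : Finset (Fin n)) : mthEvalR n 0 x A = 1 := by
  simp [mthEvalR]

lemma ev_empty (n m : ℕ) (x : Fin n → ℝ) : mthEvalR n (m+1) x ∅ = 0 := by
  unfold mthEvalR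
  rw [Finset.powersetCard_eq_empty.2 (by simp)]
  simp

lemma ev_insert (n m : ℕ) (x : Fin n → ℝ) (A : Finset (Fin n)) (d : Fin n) (hd : d ∉ A) :
    mthEvalR n (m+1) x (insert d A) = mthEvalR n (m+1) x A + x d * mthEvalR n m x A := by
  unfold mthEvalR
  rw [Finset.powersetCard_succ_insert hd, Finset.sum_union, Finset.sum_image, Finset.mul_sum]
  · congr 1
    apply Finset.sum_congr rfl
    intro S hS
    rw [Finset.prod_insert]
    intro h
    exact hd ((Finset.mem_powersetCard.1 hS).1 h)
  · intro S hS T hT h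
    have h1 : d ∉ S := fun h => hd ((Finset.mem_powersetCard.1 hS).1 h)
    have h2 : d ∉ T := fun h => hd ((Finset.mem_powersetCard.1 hT).1 h)
    have := congrArg (fun U => Finset.erase U d) h
    simpa [Finset.erase_insert h1, Finset.erase_insert h2] using this
  · rw [Finset.disjoint_left]
    intro S hS hT
    obtain ⟨T, hT, rfl⟩ := Finset.mem_image.1 hT
    exact hd ((Finset.mem_powersetCard.1 hS).1 (Finset.mem_insert_self _ _))

lemma ev_nonneg (n m : ℕ) (x : Fin n → ℝ) (hx : ∀ i, 0 ≤ x i) (A : Finset (Fin n)) :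
    0 ≤ mthEvalR n m x A :=
  Finset.sum_nonneg fun _ _ => Finset.prod_nonneg fun i _ => hx i

lemma ev_le (n : ℕ) (x : Fin n → ℝ) (hx : ∀ i, 0 ≤ x i) (B : ℝ)
    (A : Finset (Fin n)) : ∀ (m : ℕ), ∑ i ∈ A, x i ≤ B → mthEvalR n m x A ≤ B ^ m := by
  induction A using Finset.induction_on generalizing B with
  | empty =>
    intro m hB
    have hB : 0 ≤ B := by simpa using hB
    cases m with
    | zero => simp [ev_zero]
    | succ m => rw [ev_empty]; positivity
  | insert d A hd ih =>
    intro m hB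
    rw [Finset.sum_insert hd] at hB
    cases m with
    | zero => simp [ev_zero]
    | succ m =>
      rw [ev_insert _ _ _ _ _ hd]
      have hs : 0 ≤ ∑ i ∈ A, x i := Finset.sum_nonneg fun i _ => hx i
      have hxd := hx d
      have h1 := ih (B - x d) (m+1) (by linarith)
      have h2 := ih (B - x d) m (by linarith)
      have h3 : (B - x d)^m ≤ B^m := pow_le_pow_left₀ (by linarith) (by linarith) _
      have h4 : x d * mthEvalR n m x A ≤ x d * B^m := by gcongr; linarith
      have h5 : (B - x d)^m * (B - x d) ≤ B^m * (B - x d) :=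
        mul_le_mul_of_nonneg_right h3 (by linarith)
      rw [pow_succ] at h1 ⊢
      nlinarith

lemma ev_two (n : ℕ) (x : Fin n → ℝ) (A : Finset (Fin n)) :
    mthEvalR n 1 x A = ∑ i ∈ A, x i ∧
    2 * mthEvalR n 2 x A = (∑ i ∈ A, x i)^2 - ∑ i ∈ A, x i ^ 2 := by
  induction A using Finset.induction_on with
  | empty => simp [ev_empty n 0, ev_empty n 1]
  | insert d A hd ih =>
    rw [ev_insert _ 0 _ _ _ hd, ev_insert _ 1 _ _ _ hd, Finset.sum_insert hd,
      Finset.sum_insert hd, ev_zero]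
    refine ⟨by linarith [ih.1], ?_⟩
    have i2 : 2 * mthEvalR n (1+1) x A = (∑ i ∈ A, x i)^2 - ∑ i ∈ A, x i ^ 2 := ih.2
    rw [ih.1, mul_add, i2]; ring

lemma ev_diff (n : ℕ) (x : Fin n → ℝ) (hx : ∀ i, 0 ≤ x i) (B : ℝ)
    (C D : Finset (Fin n)) (hCD : Disjoint C D) (hB : ∑ i ∈ C ∪ D, x i ≤ B) (j : ℕ) :
    (0 ≤ mthEvalR n (j+1) x (C ∪ D) - mthEvalR n (j+1) x C ∧
     mthEvalR n (j+1) x (C ∪ D) - mthEvalR n (j+1) x C ≤ (∑ i ∈ D, x i) * B ^ j) := by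
  induction D using Finset.induction_on with
  | empty => simp
  | insert d D hd ih =>
    rw [Finset.disjoint_insert_right] at hCD
    have hd' : d ∉ C ∪ D := by simp [hd, hCD.1]
    rw [Finset.union_insert] at hB ⊢
    rw [Finset.sum_insert hd'] at hB
    have hxd := hx d
    have ih := ih hCD.2 (by linarith)
    rw [ev_insert _ _ _ _ _ hd', Finset.sum_insert hd]
    have h1 := ev_le n x hx B (C ∪ D) j (by linarith)
    have h2 := ev_nonneg n j x hx (C ∪ D)
    have h3 := mul_le_mul_of_nonneg_left h1 hxd
    have h4 := mul_nonneg hxd h2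
    constructor <;> linarith [ih.1, ih.2]

lemma ev_diff2 (n : ℕ) (x : Fin n → ℝ) (hx : ∀ i, 0 ≤ x i) (B : ℝ)
    (C D : Finset (Fin n)) (hCD : Disjoint C D) (hB : ∑ i ∈ C ∪ D, x i ≤ B) (j : ℕ) :
    (0 ≤ mthEvalR n (j+2) x (C ∪ D) - mthEvalR n (j+2) x C
        - mthEvalR n (j+1) x C * (∑ i ∈ D, x i) ∧
     mthEvalR n (j+2) x (C ∪ D) - mthEvalR n (j+2) x C
        - mthEvalR n (j+1) x C * (∑ i ∈ D, x i) ≤ (∑ i ∈ D, x i)^2 * B ^ j) := by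
  induction D using Finset.induction_on with
  | empty => simp
  | insert d D hd ih =>
    rw [Finset.disjoint_insert_right] at hCD
    have hd' : d ∉ C ∪ D := by simp [hd, hCD.1]
    rw [Finset.union_insert] at hB ⊢
    rw [Finset.sum_insert hd'] at hB
    have hxd := hx d
    have ih := ih hCD.2 (by linarith)
    have hs : 0 ≤ ∑ i ∈ C ∪ D, x i := Finset.sum_nonneg fun i _ => hx i
    have hsD : 0 ≤ ∑ i ∈ D, x i := Finset.sum_nonneg fun i _ => hx i
    have hB0 : 0 ≤ B ^ j := pow_nonneg (by linarith) _
    obtain ⟨h1, h2⟩ := ev_diff n x hx B C D hCD.2 (by linarith) j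
    rw [ev_insert _ (j+1) _ _ _ hd', Finset.sum_insert hd]
    have h3 := mul_le_mul_of_nonneg_left h2 hxd
    have h4 := mul_nonneg hxd h1
    have h5 : 0 ≤ x d * x d * B^j := by positivity
    have h6 : 0 ≤ x d * (∑ i ∈ D, x i) * B^j := by positivity
    constructor
    · nlinarith [ih.1, ih.2]
    · nlinarith [ih.1, ih.2]

lemma card_super {α : Type*} [DecidableEq α] (A U : Finset α) (hU : U ⊆ A) (m : ℕ)
    (hm : U.card ≤ m) :
    ((A.powersetCard m).filter (fun S => U ⊆ S)).card
      = (A.card - U.card).choose (m - U.card) := by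
  rw [← Finset.card_sdiff_of_subset hU, ← Finset.card_powersetCard]
  symm
  apply Finset.card_bij' (fun T _ => T ∪ U) (fun S _ => S \ U)
  · intro T hT
    rw [Finset.mem_powersetCard] at hT
    have hdis : Disjoint T U := Finset.disjoint_of_subset_left hT.1 Finset.sdiff_disjoint
    rw [Finset.mem_filter, Finset.mem_powersetCard, Finset.card_union_of_disjoint hdis, hT.2]
    exact ⟨⟨Finset.union_subset (hT.1.trans Finset.sdiff_subset) hU, by omega⟩,
      Finset.subset_union_right⟩
  · intro S hS
    rw [Finset.mem_filter, Finset.mem_powersetCard] at hS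
    rw [Finset.mem_powersetCard, Finset.card_sdiff_of_subset hS.2, hS.1.2]
    exact ⟨Finset.sdiff_subset_sdiff hS.1.1 le_rfl, rfl⟩
  · intro T hT
    rw [Finset.mem_powersetCard] at hT
    have hdis : Disjoint T U := Finset.disjoint_of_subset_left hT.1 Finset.sdiff_disjoint
    simp [Finset.union_sdiff_right, hdis.sdiff_eq_left]
  · intro S hS
    rw [Finset.mem_filter, Finset.mem_powersetCard] at hS
    simp [Finset.sdiff_union_of_subset hS.2]

lemma ev_expand (n m : ℕ) (x : Fin n → ℝ) (M : ℝ) (A : Finset (Fin n)) :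
    mthEvalR n m (fun i => M - x i) A = ∑ j ∈ Finset.range (m+1),
      (-1)^j * ((A.card - j).choose (m - j) : ℝ) * M^(m-j) * mthEvalR n j x A := by
  have h1 : ∀ S ∈ A.powersetCard m, ∏ i ∈ S, (M - x i) =
      ∑ j ∈ Finset.range (m+1), ∑ U ∈ S.powersetCard j, (-1)^j * M^(m-j) * ∏ i ∈ U, x i := by
    intro S hS
    have hc := (Finset.mem_powersetCard.1 hS).2
    have : ∀ i ∈ S, M - x i = -x i + M := fun i _ => by ring
    rw [Finset.prod_congr rfl this, Finset.prod_add, Finset.sum_powerset, hc]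
    apply Finset.sum_congr rfl
    intro j _
    apply Finset.sum_congr rfl
    intro U hU
    rw [Finset.mem_powersetCard] at hU
    rw [Finset.prod_const, Finset.card_sdiff_of_subset hU.1, hc, hU.2, Finset.prod_neg, hU.2]
    ring
  unfold mthEvalR
  rw [Finset.sum_congr rfl h1, Finset.sum_comm]
  apply Finset.sum_congr rfl
  intro j hj
  have hj : j ≤ m := by simpa [Nat.lt_succ_iff] using hj
  rw [Finset.sum_comm' (t' := A.powersetCard j)
    (s' := fun U => (A.powersetCard m).filter (fun S => U ⊆ S))]
  · rw [Finset.mul_sum]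
    apply Finset.sum_congr rfl
    intro U hU
    rw [Finset.mem_powersetCard] at hU
    rw [Finset.sum_const, card_super A U hU.1 m (by omega), hU.2, nsmul_eq_mul]
    ring
  · intro S U
    simp only [Finset.mem_powersetCard, Finset.mem_filter]
    constructor
    · rintro ⟨⟨a, b⟩, c, d⟩
      exact ⟨⟨⟨a, b⟩, c⟩, c.trans a, d⟩
    · rintro ⟨⟨⟨a, b⟩, c⟩, _, d⟩
      exact ⟨⟨a, b⟩, c, d⟩

lemma sum_le_geom (n t : ℕ) (b : ℝ) (hb : 0 ≤ b) (D : Finset (Fin n)) (h : ∀ i ∈ D, (i:ℕ) < t) :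
    ∑ i ∈ D, b ^ (i:ℕ) ≤ ∑ i ∈ Finset.range t, b ^ i := by
  rw [← Finset.sum_image (f := fun i => b ^ i) (s := D) (g := fun i : Fin n => (i:ℕ))
    (fun a _ b _ h => Fin.ext h)]
  apply Finset.sum_le_sum_of_subset_of_nonneg
  · intro i hi
    obtain ⟨d, hd, rfl⟩ := Finset.mem_image.1 hi
    simpa using h d hd
  · intros; positivity

lemma choose_bd (n k m j : ℕ) (hk : k ≤ n) (hn : 1 ≤ n) :
    ((k - j).choose (m - j) : ℝ) ≤ (n:ℝ)^m := by
  have : (k - j).choose (m - j) ≤ n ^ m :=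
    (Nat.choose_le_pow _ _).trans <|
      (Nat.pow_le_pow_left (by omega) _).trans (Nat.pow_le_pow_right hn (by omega))
  exact_mod_cast this

lemma sum_two_le (n : ℕ) (A : Finset (Fin n)) : ∑ i ∈ A, (2:ℝ)^(i:ℕ) ≤ 2 ^ n := by
  have := sum_le_geom n n 2 (by norm_num) A (fun i _ => i.2)
  rw [geom_sum_eq (by norm_num)] at this
  linarith

/-- different cardinalities -/
lemma case_ne (n m : ℕ) (hm : 2 ≤ m) (hn : 1 ≤ n) (M : ℝ)
    (hM : 24 * (m+1) * (n:ℝ)^m * 2^n ≤ M) (hM2 : 2 ≤ M)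
    (A₁ A₂ : Finset (Fin n)) (h1 : m ≤ A₂.card) (h2 : A₂.card < A₁.card) :
    1 ≤ mthEvalR n m (fun i => M - 2 ^ (i : ℕ)) A₁ - mthEvalR n m (fun i => M - 2 ^ (i : ℕ)) A₂ := by
  set x : Fin n → ℝ := fun i => 2 ^ (i:ℕ) with hxdef
  have hx : ∀ i, 0 ≤ x i := fun i => by simp only [hxdef]; positivity
  have hN : (1:ℝ) ≤ (n:ℝ)^m := one_le_pow₀ (by exact_mod_cast hn)
  set N : ℝ := (n:ℝ)^m with hNdef
  set B : ℝ := 2^n with hBdef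
  have hB : 1 ≤ B := one_le_pow₀ (by norm_num)
  have hmr : (0:ℝ) ≤ m := by positivity
  have hBM : B ≤ M := by
    refine le_trans ?_ hM
    have : 1 ≤ 24 * ((m:ℝ)+1) * N := by nlinarith
    nlinarith
  have key : ∀ A : Finset (Fin n),
      |mthEvalR n m (fun i => M - x i) A - (A.card.choose m : ℝ) * M^m| ≤ m * (N * B * M^(m-1)) := by
    intro A
    rw [ev_expand, Finset.sum_range_succ']
    simp only [ev_zero, pow_zero, Nat.sub_zero, one_mul, mul_one, add_sub_cancel_right]
    refine (Finset.abs_sum_le_sum_abs _ _).trans ?_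
    rw [← nsmul_eq_mul]
    conv_rhs => rw [← Finset.card_range m]
    apply Finset.sum_le_card_nsmul
    intro j hj
    have hj : j < m := by simpa using hj
    rw [abs_mul, abs_mul, abs_mul, abs_pow, abs_neg, abs_one, one_pow, one_mul,
      abs_of_nonneg (ev_nonneg n _ x hx A), Nat.abs_cast, abs_of_nonneg (by positivity)]
    have c1 := choose_bd n A.card m (j+1) (by simpa using Finset.card_le_univ A) hn
    have c2 := ev_le n x hx B A (j+1) (sum_two_le n A)
    have c3 : B^j ≤ M^j := pow_le_pow_left₀ (by linarith) hBM _
    have c4 : M^(m-(j+1)) * M^j = M^(m-1) := by rw [← pow_add]; congr 1; omega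
    have c5 := ev_nonneg n (j+1) x hx A
    calc _ ≤ N * M^(m-(j+1)) * B^(j+1) := by gcongr
      _ = N * B * (M^(m-(j+1)) * B^j) := by ring
      _ ≤ N * B * (M^(m-(j+1)) * M^j) := by gcongr
      _ = _ := by rw [c4, Finset.card_range]
  have k1 := abs_le.1 (key A₁)
  have k2 := abs_le.1 (key A₂)
  have hc : (A₂.card.choose m : ℝ) + 1 ≤ A₁.card.choose m := by
    have e1 : (A₂.card+1).choose m ≤ A₁.card.choose m := Nat.choose_le_choose _ h2
    obtain ⟨m', rfl⟩ : ∃ m', m = m'+1 := ⟨m-1, by omega⟩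
    rw [Nat.choose_succ_succ'] at e1
    have : 0 < A₂.card.choose m' := Nat.choose_pos (by omega)
    exact_mod_cast (by omega : A₂.card.choose (m'+1) + 1 ≤ A₁.card.choose (m'+1))
  have hP : M^m = M * M^(m-1) := by rw [← pow_succ']; congr 1; omega
  have hP1 : 1 ≤ M^(m-1) := one_le_pow₀ (by linarith)
  have hmN : 24 * (m * (N * B)) ≤ M := by nlinarith [mul_nonneg (by linarith : 0 ≤ N) (by linarith : 0 ≤ B)]
  have h5 := mul_le_mul_of_nonneg_right hmN (by linarith : 0 ≤ M^(m-1))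
  have h6 := mul_le_mul_of_nonneg_right hc (by rw [hP]; positivity : 0 ≤ M^m)
  have h7 : 2 * 1 ≤ M * M^(m-1) := by gcongr
  rw [← hP] at h5 h7
  linarith [k1.1, k2.2]

set_option maxHeartbeats 2000000 in
/-- equal cardinalities, `t` the top differing index -/
lemma case_eq (n m : ℕ) (hm : 2 ≤ m) (hn : 1 ≤ n) (M : ℝ)
    (hM : 24 * (m+1) * (n:ℝ)^m * 2^n ≤ M) (hM2 : 2 ≤ M)
    (A₁ A₂ : Finset (Fin n)) (h1 : m ≤ A₂.card) (h2 : A₁.card = A₂.card)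
    (t : Fin n) (ht1 : t ∈ A₁) (ht2 : t ∉ A₂) (ht : ∀ i, t < i → (i ∈ A₁ ↔ i ∈ A₂)) :
    1 ≤ mthEvalR n m (fun i => M - 2 ^ (i : ℕ)) A₂ - mthEvalR n m (fun i => M - 2 ^ (i : ℕ)) A₁ := by
  set x : Fin n → ℝ := fun i => 2 ^ (i:ℕ) with hxdef
  have hx : ∀ i, 0 ≤ x i := fun i => by simp only [hxdef]; positivity
  have hN : (1:ℝ) ≤ (n:ℝ)^m := one_le_pow₀ (by exact_mod_cast hn)
  set N : ℝ := (n:ℝ)^m with hNdef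
  set B : ℝ := 2^n with hBdef
  have hB : 1 ≤ B := one_le_pow₀ (by norm_num)
  have hmr : (2:ℝ) ≤ m := by exact_mod_cast hm
  have hBM : B ≤ M := by
    refine le_trans ?_ hM
    have : 1 ≤ 24 * ((m:ℝ)+1) * N := by nlinarith
    nlinarith
  set C := A₁ ∩ A₂
  set D₁ := A₁ \ A₂ with hD1
  set D₂ := A₂ \ A₁ with hD2
  have u1 : C ∪ D₁ = A₁ := by ext i; simp [C, D₁]; tauto
  have u2 : C ∪ D₂ = A₂ := by ext i; simp [C, D₂]; tauto
  have d1 : Disjoint C D₁ := by rw [Finset.disjoint_left]; intro i; simp [C, D₁]; tauto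
  have d2 : Disjoint C D₂ := by rw [Finset.disjoint_left]; intro i; simp [C, D₂]; tauto
  have b1 : ∀ i ∈ D₁, (i:ℕ) < t + 1 := by
    intro i hi
    by_contra hlt
    have := ht i (by rw [Fin.lt_def]; omega)
    simp [D₁] at hi
    tauto
  have b2 : ∀ i ∈ D₂, (i:ℕ) < t := by
    intro i hi
    simp [D₂] at hi
    by_contra hlt
    have hne : i ≠ t := by rintro rfl; tauto
    have hne' : (i:ℕ) ≠ t := fun h => hne (Fin.ext h)
    have := ht i (by rw [Fin.lt_def]; omega)
    tauto
  have htD : t ∈ D₁ := by simp [D₁, ht1, ht2]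
  set T : ℝ := 2^(t:ℕ) with hT
  have hT1 : 1 ≤ T := one_le_pow₀ (by norm_num)
  have s1u : ∑ i ∈ D₁, x i ≤ 2 * T := by
    have := sum_le_geom n (t+1) 2 (by norm_num) D₁ b1
    rw [geom_sum_eq (by norm_num), pow_succ] at this
    simp only [hxdef]; linarith
  have s1l : T ≤ ∑ i ∈ D₁, x i := Finset.single_le_sum (fun i _ => hx i) htD
  have s2u : ∑ i ∈ D₂, x i ≤ T - 1 := by
    have := sum_le_geom n t 2 (by norm_num) D₂ b2
    rw [geom_sum_eq (by norm_num)] at this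
    simp only [hxdef]; linarith
  have s2l : 0 ≤ ∑ i ∈ D₂, x i := Finset.sum_nonneg fun i _ => hx i
  have p1l : T^2 ≤ ∑ i ∈ D₁, x i ^ 2 :=
    Finset.single_le_sum (f := fun i => x i ^ 2) (fun i _ => sq_nonneg _) htD
  have p2u : ∑ i ∈ D₂, x i ^ 2 ≤ T^2 / 3 := by
    have := sum_le_geom n t 4 (by norm_num) D₂ b2
    rw [geom_sum_eq (by norm_num)] at this
    have e : ∀ k : ℕ, ((2:ℝ)^k)^2 = 4^k := fun k => by rw [← pow_mul, mul_comm, pow_mul]; norm_num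
    simp only [hxdef, hT, e]; linarith
  have S1 : ∑ i ∈ A₁, x i = ∑ i ∈ C, x i + ∑ i ∈ D₁, x i := by rw [← Finset.sum_union d1, u1]
  have S2 : ∑ i ∈ A₂, x i = ∑ i ∈ C, x i + ∑ i ∈ D₂, x i := by rw [← Finset.sum_union d2, u2]
  have P1 : ∑ i ∈ A₁, x i ^ 2 = ∑ i ∈ C, x i ^ 2 + ∑ i ∈ D₁, x i ^ 2 := by
    rw [← Finset.sum_union d1, u1]
  have P2 : ∑ i ∈ A₂, x i ^ 2 = ∑ i ∈ C, x i ^ 2 + ∑ i ∈ D₂, x i ^ 2 := by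
    rw [← Finset.sum_union d2, u2]
  have B1 : ∑ i ∈ A₁, x i ≤ B := sum_two_le n A₁
  have B2 : ∑ i ∈ A₂, x i ≤ B := sum_two_le n A₂
  set Δ : ℝ := ∑ i ∈ D₁, x i - ∑ i ∈ D₂, x i with hΔ
  have hΔ1 : 1 ≤ Δ := by linarith
  -- bound for j ≥ 3
  have hd : ∀ j : ℕ, |mthEvalR n (j+2) x A₂ - mthEvalR n (j+2) x A₁|
      ≤ B^(j+1) * Δ + 4 * T^2 * B^j := by
    intro j
    have q1 := ev_diff2 n x hx B C D₁ d1 (by rw [u1]; exact B1) j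
    have q2 := ev_diff2 n x hx B C D₂ d2 (by rw [u2]; exact B2) j
    rw [u1] at q1
    rw [u2] at q2
    have hBj : 0 ≤ B^j := by positivity
    have r1 : (∑ i ∈ D₁, x i)^2 * B^j ≤ 4 * T^2 * B^j := by
      apply mul_le_mul_of_nonneg_right _ hBj; nlinarith
    have r2 : (∑ i ∈ D₂, x i)^2 * B^j ≤ 4 * T^2 * B^j := by
      apply mul_le_mul_of_nonneg_right _ hBj; nlinarith
    have r3 := ev_le n x hx B C (j+1) (by linarith)
    have r4 := mul_le_mul_of_nonneg_right r3 (by linarith : 0 ≤ Δ)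
    have r5 := mul_nonneg (ev_nonneg n (j+1) x hx C) (by linarith : 0 ≤ Δ)
    have r6 : mthEvalR n (j+1) x C * Δ = mthEvalR n (j+1) x C * (∑ i ∈ D₁, x i)
      - mthEvalR n (j+1) x C * (∑ i ∈ D₂, x i) := by rw [hΔ]; ring
    rw [abs_le]
    constructor <;> linarith [q1.1, q1.2, q2.1, q2.2]
  have he2 : mthEvalR n 2 x A₂ - mthEvalR n 2 x A₁ ≥ T^2/3 - B * Δ := by
    have w1 := (ev_two n x A₁).2
    have w2 := (ev_two n x A₂).2
    rw [S1] at w1 B1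
    rw [S2] at w2 B2
    have := mul_le_mul_of_nonneg_right (by linarith : (∑ i ∈ C, x i + ∑ i ∈ D₁, x i) +
      (∑ i ∈ C, x i + ∑ i ∈ D₂, x i) ≤ 2 * B) (by linarith : 0 ≤ Δ)
    have e : (∑ i ∈ C, x i + ∑ i ∈ D₁, x i)^2 - (∑ i ∈ C, x i + ∑ i ∈ D₂, x i)^2 =
      ((∑ i ∈ C, x i + ∑ i ∈ D₁, x i) + (∑ i ∈ C, x i + ∑ i ∈ D₂, x i)) * Δ := by rw [hΔ]; ring
    linarith
  have he1 : mthEvalR n 1 x A₁ - mthEvalR n 1 x A₂ = Δ := by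
    rw [(ev_two n x A₁).1, (ev_two n x A₂).1, S1, S2]; ring
  obtain ⟨l, rfl⟩ : ∃ l, m = l + 2 := ⟨m-2, by omega⟩
  have hM0 : 0 < M := by linarith
  have hMl : 0 < M^l := by positivity
  rw [ev_expand, ev_expand, h2, ← Finset.sum_sub_distrib, Finset.sum_range_succ',
    Finset.sum_range_succ', Finset.sum_range_succ']
  simp only [ev_zero, sub_self, add_zero, zero_add]
  set k := A₂.card
  have kn : k ≤ n := by simpa using Finset.card_le_univ A₂
  have c1 : (1:ℝ) ≤ ((k-1).choose (l+2-1) : ℝ) := by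
    exact_mod_cast Nat.choose_pos (by omega)
  have c2 : (1:ℝ) ≤ ((k-(1+1)).choose (l+2-(1+1)) : ℝ) := by
    exact_mod_cast Nat.choose_pos (by omega)
  have c2' := choose_bd n k (l+2) (1+1) kn hn
  have hrest : |∑ j ∈ Finset.range l, ((-1)^(j+1+1+1) * ((k-(j+1+1+1)).choose (l+2-(j+1+1+1)) : ℝ)
      * M^(l+2-(j+1+1+1)) * mthEvalR n (j+1+1+1) x A₂ -
      (-1)^(j+1+1+1) * ((k-(j+1+1+1)).choose (l+2-(j+1+1+1)) : ℝ)
      * M^(l+2-(j+1+1+1)) * mthEvalR n (j+1+1+1) x A₁)| ≤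
      l * (N * B * M^l * Δ + 4 * T^2 * (N * B * M^(l-1))) := by
    refine (Finset.abs_sum_le_sum_abs _ _).trans ?_
    rw [← nsmul_eq_mul]
    conv_rhs => rw [← Finset.card_range l]
    apply Finset.sum_le_card_nsmul
    intro j hj
    have hj : j < l := by simpa using hj
    rw [← mul_sub, abs_mul, abs_mul, abs_mul, abs_pow, abs_neg, abs_one, one_pow, one_mul,
      Nat.abs_cast, abs_of_nonneg (by positivity)]
    have c1 := choose_bd n k (l+2) (j+1+1+1) kn hn
    have c3 : B^j ≤ M^j := pow_le_pow_left₀ (by linarith) hBM _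
    have c4 : M^(l+2-(j+1+1+1)) * M^j = M^(l-1) := by rw [← pow_add]; congr 1; omega
    have c4' : M^(l+2-(j+1+1+1)) * (M * M^j) = M^l := by
      rw [← pow_succ', ← pow_add]; congr 1; omega
    have hΔ0 : 0 ≤ Δ := by linarith
    calc _ ≤ N * M^(l+2-(j+1+1+1)) * (B^(j+1+1) * Δ + 4 * T^2 * B^(j+1)) := by
          gcongr; exact hd (j+1)
      _ = N * B * (M^(l+2-(j+1+1+1)) * (B * B^j)) * Δ
          + 4 * T^2 * (N * B * (M^(l+2-(j+1+1+1)) * B^j)) := by ring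
      _ ≤ N * B * (M^(l+2-(j+1+1+1)) * (M * M^j)) * Δ
          + 4 * T^2 * (N * B * (M^(l+2-(j+1+1+1)) * M^j)) := by gcongr
      _ = _ := by rw [c4, c4', Finset.card_range]
  have hrest := (abs_le.1 hrest).1
  refine le_trans ?_ (add_le_add (add_le_add hrest le_rfl) le_rfl)
  rw [show l + 2 - 1 = l + 1 from rfl] at *
  rw [show l + 2 - (1+1) = l from rfl] at *
  rw [← mul_sub, ← mul_sub, ← neg_sub (mthEvalR n 1 x A₁), he1]
  set a := ((k-1).choose (l+1) : ℝ)
  set b := ((k-(1+1)).choose l : ℝ)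
  set E := mthEvalR n (1+1) x A₂ - mthEvalR n (1+1) x A₁
  have he2 : E ≥ T^2/3 - B * Δ := he2
  -- pieces
  have hΔ0 : 0 ≤ Δ := by linarith
  have g1 : M^(l+1) * Δ ≤ a * (M^(l+1) * Δ) := le_mul_of_one_le_left (by positivity) c1
  have g2 : M^l * (T^2/3) - N * (B * Δ * M^l) ≤ b * M^l * E := by
    have f1 := mul_le_mul_of_nonneg_left he2 (by positivity : 0 ≤ b * M^l)
    have f2 : M^l * (T^2/3) ≤ b * (M^l * (T^2/3)) := le_mul_of_one_le_left (by positivity) c2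
    have f3 : b * (B * Δ * M^l) ≤ N * (B * Δ * M^l) :=
      mul_le_mul_of_nonneg_right c2' (by positivity)
    linarith
  push_cast at hM
  have hNB : 0 ≤ N * B := by positivity
  have hlNB : 0 ≤ l * (N * B) := by positivity
  have g3 : l * (4 * T^2 * (N * B * M^(l-1))) ≤ M^l * (T^2/3) := by
    rcases Nat.eq_zero_or_pos l with rfl | hl
    · simp; positivity
    · have e : M^l = M * M^(l-1) := by rw [← pow_succ']; congr 1; omega
      have f1 : 12 * (l * (N * B)) ≤ M := by linarith
      have := mul_le_mul_of_nonneg_right f1 (by positivity : 0 ≤ M^(l-1) * (T^2/3))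
      rw [e]; linarith
  have g4 : 2 * ((l+1) * (N * B)) ≤ M := by linarith
  have g5 := mul_le_mul_of_nonneg_right g4 (by positivity : 0 ≤ M^l * Δ)
  have g6 : 2 * 1 * 1 ≤ M * M^l * Δ := by
    gcongr
    exact one_le_pow₀ (by linarith)
  have e : M^(l+1) = M * M^l := pow_succ' _ _
  rw [e] at g1 ⊢
  norm_num
  linarith

lemma eventually_big (ε : ℝ) (hε : 0 < ε) (m : ℕ) :
    ∃ n₀ : ℕ, ∀ n : ℕ, n₀ ≤ n → 24 * (m+1) * (n:ℝ)^m * 2^n ≤ (2+ε)^n := by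
  have h := tendsto_pow_const_mul_const_pow_of_abs_lt_one m (r := 2/(2+ε))
    (by rw [abs_of_pos (by positivity), div_lt_one (by positivity)]; linarith)
  have h2 := h.eventually (gt_mem_nhds (by positivity : (0:ℝ) < 1/(24*(m+1))))
  obtain ⟨n₀, hn⟩ := Filter.eventually_atTop.1 h2
  refine ⟨n₀, fun n h => ?_⟩
  have := hn n h
  rw [div_pow, lt_div_iff₀ (by positivity), ← mul_div_assoc, div_mul_eq_mul_div,
    div_lt_one (by positivity)] at this
  linarith

theorem stmt14 (ε : ℝ) (hε : 0 < ε) (m : ℕ) (hm : 2 ≤ m) :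
    ∃ n₀ : ℕ, ∀ n : ℕ, n₀ ≤ n →
      ∀ A₁ A₂ : Finset (Fin n), A₁ ≠ A₂ → m ≤ A₁.card → m ≤ A₂.card →
        1 ≤ |mthEvalR n m (fun i => (2 + ε) ^ n - 2 ^ (i : ℕ)) A₁ -
              mthEvalR n m (fun i => (2 + ε) ^ n - 2 ^ (i : ℕ)) A₂| := by
  obtain ⟨n₀, hn₀⟩ := eventually_big ε hε m
  refine ⟨n₀ + 1, fun n hn A₁ A₂ hne h1 h2 => ?_⟩
  have hM := hn₀ n (by omega)
  have hn1 : 1 ≤ n := by omega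
  have hM2 : 2 ≤ (2+ε)^n := by
    have := le_self_pow₀ (by linarith : 1 ≤ 2 + ε) (by omega : n ≠ 0)
    linarith
  rcases lt_trichotomy A₁.card A₂.card with h | h | h
  · rw [abs_sub_comm]
    exact (case_ne n m hm hn1 _ hM hM2 A₂ A₁ h1 h).trans (le_abs_self _)
  · have hS : (symmDiff A₁ A₂).Nonempty := by
      rw [Finset.nonempty_iff_ne_empty]
      intro h
      exact hne (symmDiff_eq_bot.1 h)
    set t := (symmDiff A₁ A₂).max' hS with htdef
    have htm : t ∈ symmDiff A₁ A₂ := Finset.max'_mem _ _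
    have ht : ∀ i, t < i → (i ∈ A₁ ↔ i ∈ A₂) := by
      intro i hi
      have : i ∉ symmDiff A₁ A₂ := fun h => absurd (Finset.le_max' _ i h) (not_le.2 hi)
      rw [Finset.mem_symmDiff] at this
      tauto
    rw [Finset.mem_symmDiff] at htm
    rcases htm with ⟨a, b⟩ | ⟨a, b⟩
    · rw [abs_sub_comm]
      exact (case_eq n m hm hn1 _ hM hM2 A₁ A₂ h2 h t a b ht).trans (le_abs_self _)
    · exact (case_eq n m hm hn1 _ hM hM2 A₂ A₁ h1 h.symm t a b
        (fun i hi => (ht i hi).symm)).trans (le_abs_self _)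
  · exact (case_ne n m hm hn1 _ hM hM2 A₁ A₂ h2 h).trans (le_abs_self _)
end
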